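/- arXiv:1612.00515 — 9 statements merged into one kernel-verified Lean document; each statement's English description precedes it below -/
import Mathlib

section
/- Let φ : [0,∞) → (0,∞) be continuously differentiable with φ(x) → ∞ as x → ∞, φ'(x) > 0 for all x ≥ 0, and φ' nonincreasing with φ'(x) → 0 as x → ∞. If x, y : [0,∞) → (0,∞) are continuous with x(t) → ∞, y(t) → ∞ and x(t)/y(t) → 1 as t → ∞, then φ(x(t))/φ(y(t)) → 1 as t → ∞. -/
open Filter MeasureTheory

/-- Under hypothesis (A4) on `φ` (`C¹`, `φ → ∞`, `φ' > 0`, `φ'` nonincreasing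
with `φ' → 0`), `φ` preserves asymptotic equivalence: if `x, y : [0,∞) → (0,∞)` are
continuous, tend to `∞`, and `x(t)/y(t) → 1`, then `φ(x(t))/φ(y(t)) → 1`. -/
theorem stmt2 (φ φd x y : ℝ → ℝ)
    (hφ_deriv : ∀ u ∈ Set.Ici (0:ℝ), HasDerivAt φ (φd u) u)
    (hφd_cont : ContinuousOn φd (Set.Ici 0))
    (hφ_pos : ∀ u ∈ Set.Ici (0:ℝ), 0 < φ u)
    (hφ_inf : Tendsto φ atTop atTop)
    (hφd_pos : ∀ u ∈ Set.Ici (0:ℝ), 0 < φd u)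
    (hφd_anti : AntitoneOn φd (Set.Ici 0))
    (hφd_zero : Tendsto φd atTop (nhds 0))
    (hx_cont : ContinuousOn x (Set.Ici 0)) (hy_cont : ContinuousOn y (Set.Ici 0))
    (hx_pos : ∀ t ≥ (0:ℝ), 0 < x t) (hy_pos : ∀ t ≥ (0:ℝ), 0 < y t)
    (hx_inf : Tendsto x atTop atTop) (hy_inf : Tendsto y atTop atTop)
    (hequiv : Tendsto (fun t => x t / y t) atTop (nhds 1)) :
    Tendsto (fun t => φ (x t) / φ (y t)) atTop (nhds 1) := by
  have hcont : ContinuousOn φ (Set.Ici 0) :=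
    fun u hu => (hφ_deriv u hu).continuousAt.continuousWithinAt
  have hint : ∀ u ∈ interior (Set.Ici (0:ℝ)), u ∈ Set.Ici (0:ℝ) :=
    fun u hu => interior_subset hu
  have hmono : MonotoneOn φ (Set.Ici 0) := by
    refine monotoneOn_of_deriv_nonneg (convex_Ici 0) hcont
      (fun u hu => (hφ_deriv u (hint u hu)).differentiableAt.differentiableWithinAt) ?_
    intro u hu
    rw [(hφ_deriv u (hint u hu)).deriv]
    exact (hφd_pos u (hint u hu)).le
  have hconc : ConcaveOn ℝ (Set.Ici 0) φ := by
    refine AntitoneOn.concaveOn_of_deriv (convex_Ici 0) hcont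
      (fun u hu => (hφ_deriv u (hint u hu)).differentiableAt.differentiableWithinAt) ?_
    intro u hu v hv huv
    rw [(hφ_deriv u (hint u hu)).deriv, (hφ_deriv v (hint v hv)).deriv]
    exact hφd_anti (hint u hu) (hint v hv) huv
  have key : ∀ a b : ℝ, 0 < a → a ≤ b → a / b ≤ φ a / φ b ∧ φ a / φ b ≤ 1 := by
    intro a b ha hab
    have hb : 0 < b := ha.trans_le hab
    have ha' : a ∈ Set.Ici (0:ℝ) := ha.le
    have hb' : b ∈ Set.Ici (0:ℝ) := hb.le
    have hpb := hφ_pos b hb'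
    have h0 : (0:ℝ) ∈ Set.Ici (0:ℝ) := le_refl (0:ℝ)
    have hp0 := hφ_pos 0 h0
    have hle : a / b ≤ 1 := (div_le_one hb).2 hab
    have h := hconc.2 hb' h0 (div_pos ha hb).le (sub_nonneg.2 hle) (by ring)
    simp only [smul_eq_mul, mul_zero, add_zero, div_mul_cancel₀ a hb.ne'] at h
    refine ⟨(le_div_iff₀ hpb).2 ?_, (div_le_one hpb).2 (hmono ha' hb' hab)⟩
    have := mul_nonneg (sub_nonneg.2 hle) hp0.le
    linarith
  have hinv : Tendsto (fun t => (x t / y t)⁻¹) atTop (nhds 1) := by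
    simpa using hequiv.inv₀ one_ne_zero
  have hmin := hequiv.min hinv
  have hmax := hequiv.max hinv
  rw [min_self] at hmin
  rw [max_self] at hmax
  refine tendsto_of_tendsto_of_tendsto_of_le_of_le' hmin hmax ?_ ?_
  all_goals
    filter_upwards [eventually_ge_atTop (0:ℝ)] with t ht
    have hx := hx_pos t ht
    have hy := hy_pos t ht
    have hpx := hφ_pos _ (show x t ∈ Set.Ici (0:ℝ) from hx.le)
    have hpy := hφ_pos _ (show y t ∈ Set.Ici (0:ℝ) from hy.le)
    rcases le_total (x t) (y t) with h | h
  · exact (min_le_left _ _).trans (key _ _ hx h).1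
  · refine (min_le_right _ _).trans ?_
    rw [inv_div]
    exact ((div_le_one hx).2 h).trans ((one_le_div hpy).2
      ((div_le_one hpx).1 (key _ _ hy h).2))
  · refine ((key _ _ hx h).2.trans ?_).trans (le_max_right _ _)
    rw [inv_div]
    exact (one_le_div hx).2 h
  · refine le_trans ?_ (le_max_left _ _)
    have h1 := inv_anti₀ (div_pos hy hx) (key _ _ hy h).1
    rwa [inv_div, inv_div] at h1
end

section
/- Suppose φ : (0,∞) → (0,∞) is continuous and strictly increasing, M ∈ (0,∞), and γ : [0,∞) → (0,∞) is continuous. If γ(t)/(M ∫₀ᵗ φ(γ(s)) ds) → ∞ as t → ∞, then Φ(γ(t))/(M t) → ∞ as t → ∞. -/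
open Filter MeasureTheory

/-- `Φ(x) = ∫₁ˣ du / φ(u)`. -/
noncomputable def Phifun (φ : ℝ → ℝ) (x : ℝ) : ℝ := ∫ u in (1:ℝ)..x, 1 / φ u

lemma Phifun_hasDerivAt (φ : ℝ → ℝ)
    (hφ_cont : ContinuousOn φ (Set.Ioi 0)) (hφ_pos : ∀ u > (0:ℝ), 0 < φ u)
    (x : ℝ) (hx : 0 < x) : HasDerivAt (Phifun φ) (1 / φ x) x := by
  have hc : ContinuousOn (fun u => 1 / φ u) (Set.Ioi 0) :=
    continuousOn_const.div hφ_cont (fun u hu => (hφ_pos u hu).ne')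
  unfold Phifun
  apply intervalIntegral.integral_hasDerivAt_right
  · apply (hc.mono _).intervalIntegrable
    intro u hu
    exact lt_of_lt_of_le (lt_min one_pos hx) hu.1
  · exact hc.stronglyMeasurableAtFilter isOpen_Ioi x hx
  · exact hc.continuousAt (Ioi_mem_nhds hx)

/-- If `φ : (0,∞) → (0,∞)` is continuous and strictly increasing,
`M ∈ (0,∞)`, `γ : [0,∞) → (0,∞)` is continuous, and
`γ(t)/(M ∫₀ᵗ φ(γ(s)) ds) → ∞` as `t → ∞`, then `Φ(γ(t))/(M t) → ∞`. -/
theorem stmt4 (φ γ : ℝ → ℝ) (M : ℝ) (hM : 0 < M)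
    (hφ_cont : ContinuousOn φ (Set.Ioi 0)) (hφ_pos : ∀ u > (0:ℝ), 0 < φ u)
    (hφ_mono : StrictMonoOn φ (Set.Ioi 0))
    (hγ_cont : ContinuousOn γ (Set.Ici 0)) (hγ_pos : ∀ t ≥ (0:ℝ), 0 < γ t)
    (hlim : Tendsto (fun t => γ t / (M * ∫ s in (0:ℝ)..t, φ (γ s))) atTop atTop) :
    Tendsto (fun t => Phifun φ (γ t) / (M * t)) atTop atTop := by
  have hg : ContinuousOn (fun s => φ (γ s)) (Set.Ici 0) :=
    hφ_cont.comp hγ_cont (fun t ht => hγ_pos t ht)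
  have hgi : ∀ t, 0 < t → IntervalIntegrable (fun s => φ (γ s)) volume 0 t := by
    intro t ht
    apply (hg.mono _).intervalIntegrable
    intro u hu
    rw [Set.uIcc_of_le ht.le] at hu
    exact hu.1
  have hIpos : ∀ t, 0 < t → 0 < ∫ s in (0:ℝ)..t, φ (γ s) := by
    intro t ht
    apply intervalIntegral.intervalIntegral_pos_of_pos_on (hgi t ht) _ ht
    intro s hs
    exact hφ_pos _ (hγ_pos s hs.1.le)
  have hId : ∀ t, 0 < t → HasDerivAt (fun t => ∫ s in (0:ℝ)..t, φ (γ s)) (φ (γ t)) t := by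
    intro t ht
    apply intervalIntegral.integral_hasDerivAt_right (hgi t ht)
    · exact (hg.mono Set.Ioi_subset_Ici_self).stronglyMeasurableAtFilter isOpen_Ioi t ht
    · exact hg.continuousAt (Ici_mem_nhds ht)
  rw [tendsto_atTop]
  intro b
  set K : ℝ := |b| + 1 with hK
  have hKpos : 0 < K := by positivity
  obtain ⟨T0, hT0⟩ := eventually_atTop.1 (tendsto_atTop.1 hlim K)
  set T : ℝ := max T0 1 with hT
  have hT1 : 1 ≤ T := le_max_right _ _
  set J : ℝ → ℝ := fun t => K * M * ∫ s in (0:ℝ)..t, φ (γ s) with hJ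
  have hJpos : ∀ t, 0 < t → 0 < J t := fun t ht => mul_pos (mul_pos hKpos hM) (hIpos t ht)
  have hJd : ∀ t, 0 < t → HasDerivAt J (K * M * φ (γ t)) t := fun t ht =>
    (hId t ht).const_mul _
  have hJle : ∀ t, T ≤ t → J t ≤ γ t := by
    intro t ht
    have h := hT0 t ((le_max_left _ _).trans ht)
    have h1 := hIpos t (by linarith)
    rw [le_div_iff₀ (mul_pos hM h1)] at h
    simp only [hJ]; linarith
  have hFd : ∀ t, 0 < t → HasDerivAt (fun t => Phifun φ (J t) - K * M * t)
      (1 / φ (J t) * (K * M * φ (γ t)) - K * M * 1) t := fun t ht =>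
    ((Phifun_hasDerivAt φ hφ_cont hφ_pos (J t) (hJpos t ht)).comp t (hJd t ht)).sub
      ((hasDerivAt_id t).const_mul (K * M))
  have hmono : MonotoneOn (fun t => Phifun φ (J t) - K * M * t) (Set.Ici T) := by
    apply monotoneOn_of_deriv_nonneg (convex_Ici T)
    · intro t ht
      exact (hFd t (by linarith [Set.mem_Ici.1 ht])).continuousAt.continuousWithinAt
    · intro t ht
      rw [interior_Ici] at ht
      exact (hFd t (by linarith [Set.mem_Ioi.1 ht])).differentiableAt.differentiableWithinAt
    · intro t ht
      rw [interior_Ici] at ht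
      have ht' : T < t := ht
      have ht0 : 0 < t := by linarith
      rw [(hFd t ht0).deriv]
      have hp := hφ_pos _ (hJpos t ht0)
      have hle : φ (J t) ≤ φ (γ t) :=
        hφ_mono.monotoneOn (hJpos t ht0) (hγ_pos t ht0.le) (hJle t ht'.le)
      have h1 : 1 ≤ φ (γ t) / φ (J t) := (one_le_div hp).2 hle
      have h2 : 1 / φ (J t) * (K * M * φ (γ t)) - K * M * 1
          = K * M * (φ (γ t) / φ (J t) - 1) := by ring
      rw [h2]
      exact mul_nonneg (by positivity) (by linarith)
  have hPmono : MonotoneOn (Phifun φ) (Set.Ioi 0) := by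
    apply monotoneOn_of_deriv_nonneg (convex_Ioi 0)
    · intro t ht
      exact (Phifun_hasDerivAt φ hφ_cont hφ_pos t ht).continuousAt.continuousWithinAt
    · intro t ht
      rw [interior_Ioi] at ht
      exact (Phifun_hasDerivAt φ hφ_cont hφ_pos t ht).differentiableAt.differentiableWithinAt
    · intro t ht
      rw [interior_Ioi] at ht
      rw [(Phifun_hasDerivAt φ hφ_cont hφ_pos t ht).deriv]
      exact (one_div_pos.2 (hφ_pos t ht)).le
  filter_upwards [eventually_ge_atTop T,
    eventually_ge_atTop ((K * M * T - Phifun φ (J T)) / M)] with t ht ht2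
  have ht0 : 0 < t := by linarith
  rw [le_div_iff₀ (mul_pos hM ht0)]
  rw [div_le_iff₀ hM] at ht2
  have h1 := hmono (Set.mem_Ici.2 le_rfl) (Set.mem_Ici.2 ht) ht
  simp only at h1
  have h2 := hPmono (hJpos t ht0) (hγ_pos t ht0.le) (hJle t ht)
  have h3 : 0 ≤ (K - b - 1) * (M * t) :=
    mul_nonneg (by rw [hK]; linarith [le_abs_self b]) (by positivity)
  nlinarith
end

section
/- Assume (A1), (A2) with (A4), (A±), and (F1): γ : (0,∞) → (0,∞) is continuous, increasing, γ(t) → ∞ as t → ∞, and limsup_{t→∞} |H(t)|/γ(t) = 1. If γ(t)/(M ∫₀ᵗ f(γ(s)) ds) → L as t → ∞ for some L ∈ (1,∞), then limsup_{t→∞} |x(t)|/γ(t) ≤ L/(L−1); in particular the limsup is finite. -/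
open Filter MeasureTheory

lemma aux_scale (φ φd : ℝ → ℝ)
    (hφ_deriv : ∀ y ≥ (0:ℝ), HasDerivAt φ (φd y) y)
    (hφ_pos : ∀ y ≥ (0:ℝ), 0 < φ y)
    (hφd_anti : AntitoneOn φd (Set.Ici 0)) (K y : ℝ) (hK : 1 ≤ K) (hy : 0 ≤ y) :
    φ (K * y) ≤ K * φ y := by
  have hc : ConcaveOn ℝ (Set.Ici 0) φ := by
    apply AntitoneOn.concaveOn_of_deriv (convex_Ici 0)
    · intro y hy
      exact (hφ_deriv y hy).continuousAt.continuousWithinAt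
    · intro y hy
      rw [interior_Ici] at hy
      exact (hφ_deriv y (le_of_lt hy)).differentiableAt.differentiableWithinAt
    · rw [interior_Ici]
      intro a ha b hb hab
      rw [(hφ_deriv a (le_of_lt ha)).deriv, (hφ_deriv b (le_of_lt hb)).deriv]
      exact hφd_anti (Set.mem_Ici.2 (le_of_lt ha)) (Set.mem_Ici.2 (le_of_lt hb)) hab
  have hK0 : 0 < K := by linarith
  have hK1 : 1 / K ≤ 1 := by rw [div_le_one hK0]; exact hK
  have h := hc.2 (show K * y ∈ Set.Ici (0:ℝ) from mul_nonneg hK0.le hy)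
    (show (0:ℝ) ∈ Set.Ici (0:ℝ) by simp)
    (show 0 ≤ 1 / K by positivity) (show 0 ≤ 1 - 1 / K by linarith) (by ring)
  simp only [smul_eq_mul, mul_zero, add_zero] at h
  have e : 1 / K * (K * y) = y := by field_simp
  rw [e] at h
  have h0 : 0 ≤ (1 - 1 / K) * φ 0 := mul_nonneg (by linarith) (hφ_pos 0 le_rfl).le
  have h1 : 1 / K * φ (K * y) ≤ φ y := by linarith
  have h2 := mul_le_mul_of_nonneg_left h1 hK0.le
  have e2 : K * (1 / K * φ (K * y)) = φ (K * y) := by field_simp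
  linarith

lemma aux_mono (φ φd : ℝ → ℝ)
    (hφ_deriv : ∀ y ≥ (0:ℝ), HasDerivAt φ (φd y) y)
    (hφd_pos : ∀ y ≥ (0:ℝ), 0 < φd y) : MonotoneOn φ (Set.Ici 0) := by
  apply monotoneOn_of_deriv_nonneg (convex_Ici 0)
  · intro y hy
    exact (hφ_deriv y hy).continuousAt.continuousWithinAt
  · intro y hy
    rw [interior_Ici] at hy
    exact (hφ_deriv y (le_of_lt hy)).differentiableAt.differentiableWithinAt
  · intro y hy
    rw [interior_Ici] at hy
    rw [(hφ_deriv y (le_of_lt hy)).deriv]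
    exact (hφd_pos y (le_of_lt hy)).le

lemma aux_cocompact {p : ℝ → Prop} (h : ∀ᶠ y in Filter.cocompact ℝ, p y) :
    ∃ R > 0, ∀ y, R ≤ |y| → p y := by
  have hb := (Metric.hasBasis_cobounded_compl_closedBall (0:ℝ))
  rw [Metric.cobounded_eq_cocompact] at hb
  obtain ⟨R, -, hR⟩ := hb.eventually_iff.1 h
  refine ⟨|R| + 1, by positivity, fun y hy => hR ?_⟩
  simp only [Set.mem_compl_iff, Metric.mem_closedBall, dist_zero_right, Real.norm_eq_abs, not_le]
  linarith [le_abs_self R]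

lemma aux_upper (f φ : ℝ → ℝ) (hf_cont : Continuous f)
    (hφ_pos : ∀ y ≥ (0:ℝ), 0 < φ y)
    (hfφ : Tendsto (fun y => |f y| / φ |y|) (Filter.cocompact ℝ) (nhds 1))
    (δ : ℝ) (hδ : 0 < δ) : ∃ C ≥ 0, ∀ y, |f y| ≤ (1 + δ) * φ |y| + C := by
  obtain ⟨R, hR, h⟩ := aux_cocompact (hfφ.eventually (gt_mem_nhds (show (1:ℝ) < 1 + δ by linarith)))
  obtain ⟨C, hC⟩ := (isCompact_Icc (a := -R) (b := R)).exists_bound_of_continuousOn hf_cont.continuousOn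
  refine ⟨|C|, abs_nonneg _, fun y => ?_⟩
  have hp := hφ_pos |y| (abs_nonneg y)
  rcases le_total R |y| with hy | hy
  · have := h y hy
    rw [div_lt_iff₀ hp] at this
    linarith [abs_nonneg C]
  · have := hC y (abs_le.1 hy)
    rw [Real.norm_eq_abs] at this
    have h3 : 0 ≤ (1 + δ) * φ |y| := by positivity
    linarith [le_abs_self C]

lemma aux_int (f γ : ℝ → ℝ) (hf_cont : Continuous f)
    (hγ_cont : ContinuousOn γ (Set.Ioi 0)) (hγ_pos : ∀ t > (0:ℝ), 0 < γ t)
    (hγ_mono : StrictMonoOn γ (Set.Ioi 0)) (t : ℝ) (ht : 0 ≤ t) :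
    IntervalIntegrable (fun s => f (γ s)) volume 0 t := by
  rw [intervalIntegrable_iff_integrableOn_Ioc_of_le ht]
  obtain ⟨C, hC⟩ := (isCompact_Icc (a := 0) (b := γ t)).exists_bound_of_continuousOn
    hf_cont.continuousOn
  refine Integrable.of_bound ?_ C ?_
  · apply ContinuousOn.aestronglyMeasurable _ measurableSet_Ioc
    exact hf_cont.comp_continuousOn (hγ_cont.mono (fun s hs => hs.1))
  · rw [ae_restrict_iff' measurableSet_Ioc]
    refine Eventually.of_forall fun s hs => hC _ ⟨(hγ_pos s hs.1).le, ?_⟩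
    exact hγ_mono.monotoneOn hs.1 (lt_of_lt_of_le hs.1 hs.2) hs.2

/-- positivity of `f` far out and the lower comparison. -/
lemma aux_lower (M : ℝ) (hM : 0 < M) (f φ γ : ℝ → ℝ) (L : ℝ) (hL : 1 < L)
    (hf_cont : Continuous f)
    (hφ_pos : ∀ y ≥ (0:ℝ), 0 < φ y)
    (hφ_mono : MonotoneOn φ (Set.Ici 0))
    (hfφ : Tendsto (fun y => |f y| / φ |y|) (Filter.cocompact ℝ) (nhds 1))
    (hint : ∀ t ≥ 0, IntervalIntegrable (fun s => f (γ s)) volume 0 t)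
    (hγ_pos : ∀ t > (0:ℝ), 0 < γ t)
    (hγ_inf : Tendsto γ atTop atTop)
    (hLγ : Tendsto (fun t => γ t / (M * ∫ s in (0:ℝ)..t, f (γ s))) atTop (nhds L))
    (δ : ℝ) (hδ : 0 < δ) : ∃ S > 0, ∀ s ≥ S, φ (γ s) ≤ (1 + δ) * f (γ s) := by
  have h1 : 1 / (1 + δ) < 1 := by rw [div_lt_one (by linarith)]; linarith
  obtain ⟨R, hR, h⟩ := aux_cocompact (hfφ.eventually (lt_mem_nhds h1))
  have hA : ∀ y, R ≤ y → φ y ≤ (1 + δ) * |f y| := by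
    intro y hy
    have hy0 : 0 ≤ y := by linarith
    have hp := hφ_pos y hy0
    have := h y (by rwa [abs_of_nonneg hy0])
    rw [abs_of_nonneg hy0, lt_div_iff₀ hp, one_div_mul_eq_div, div_lt_iff₀ (by linarith)] at this
    linarith
  have hne : ∀ y, R ≤ y → f y ≠ 0 := by
    intro y hy h0
    have := hA y hy
    rw [h0] at this
    have hp := hφ_pos y (by linarith)
    simp at this; linarith
  obtain ⟨S, hS⟩ := eventually_atTop.1 (hγ_inf.eventually_ge_atTop R)
  by_cases hpos : 0 < f R
  · refine ⟨|S| + 1, by positivity, fun s hs => ?_⟩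
    have hs' := hS s (by linarith [le_abs_self S])
    have : 0 < f (γ s) := by
      by_contra hcon
      push Not at hcon
      obtain ⟨z, hz, hz0⟩ := intermediate_value_Icc' hs' hf_cont.continuousOn ⟨hcon, hpos.le⟩
      exact hne z hz.1 hz0
    have := hA _ hs'
    rwa [abs_of_pos ‹_›] at this
  · exfalso
    have hneg : f R < 0 := lt_of_le_of_ne (not_lt.1 hpos) (hne R le_rfl)
    have hfn : ∀ y, R ≤ y → f y < 0 := by
      intro y hy
      by_contra hcon
      push Not at hcon
      obtain ⟨z, hz, hz0⟩ := intermediate_value_Icc hy hf_cont.continuousOn ⟨hneg.le, hcon⟩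
      exact hne z hz.1 hz0
    set S' := |S| + 1 with hS'
    have hS'0 : 0 < S' := by positivity
    set c := φ 0 / (1 + δ) with hc
    have hc0 : 0 < c := div_pos (hφ_pos 0 le_rfl) (by linarith)
    have hb : ∀ s ≥ S', f (γ s) ≤ -c := by
      intro s hs
      have hs' := hS s (by linarith [le_abs_self S])
      have a1 := hA _ hs'
      rw [abs_of_neg (hfn _ hs')] at a1
      have a2 := hφ_mono (Set.mem_Ici.2 le_rfl) (Set.mem_Ici.2 (hR.le.trans hs')) (hR.le.trans hs')
      have : c ≤ - f (γ s) := by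
        rw [hc, div_le_iff₀ (by linarith)]; linarith
      linarith
    set I := ∫ s in (0:ℝ)..S', f (γ s) with hI
    have hev := hLγ.eventually (lt_mem_nhds (show 0 < L by linarith))
    obtain ⟨t, ht1, ht2, ht3⟩ := (hev.and ((eventually_ge_atTop S').and
      (eventually_ge_atTop (S' + |I| / c)))).exists
    have ht0 : 0 ≤ t := by linarith
    have i2 : IntervalIntegrable (fun s => f (γ s)) volume S' t :=
      (hint S' hS'0.le).symm.trans (hint t ht0)
    have hsplit := intervalIntegral.integral_add_adjacent_intervals (hint S' hS'0.le) i2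
    have hle : ∫ s in S'..t, f (γ s) ≤ ∫ s in S'..t, (-c) :=
      intervalIntegral.integral_mono_on ht2 i2 (by simp) (fun s hs => hb s hs.1)
    rw [intervalIntegral.integral_const, smul_eq_mul] at hle
    have h5 : |I| ≤ (t - S') * c := by
      rw [← div_le_iff₀ hc0]; linarith
    have h6 : ∫ s in (0:ℝ)..t, f (γ s) ≤ 0 := by
      rw [← hsplit]; linarith [le_abs_self I]
    have h7 : γ t / (M * ∫ s in (0:ℝ)..t, f (γ s)) ≤ 0 :=
      div_nonpos_of_nonneg_of_nonpos (hγ_pos t (by linarith)).le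
        (mul_nonpos_of_nonneg_of_nonpos hM.le h6)
    linarith

/-- two-sided control of `M ∫ f(γ)` by `γ`. -/
lemma aux_phi (M : ℝ) (hM : 0 < M) (f γ : ℝ → ℝ) (L : ℝ) (hL : 1 < L)
    (hγ_pos : ∀ t > (0:ℝ), 0 < γ t)
    (hLγ : Tendsto (fun t => γ t / (M * ∫ s in (0:ℝ)..t, f (γ s))) atTop (nhds L))
    (δ : ℝ) (hδ : 0 < δ) : ∃ S > 0, ∀ t ≥ S, 0 ≤ (∫ s in (0:ℝ)..t, f (γ s)) ∧
      M * (∫ s in (0:ℝ)..t, f (γ s)) ≤ (1 / L + δ) * γ t := by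
  have h := hLγ.inv₀ (by linarith)
  have e1 := h.eventually (gt_mem_nhds (show L⁻¹ < 1 / L + δ by rw [one_div]; linarith))
  have e2 := h.eventually (lt_mem_nhds (show 0 < L⁻¹ by positivity))
  obtain ⟨S, hS⟩ := eventually_atTop.1 (e1.and e2)
  refine ⟨|S| + 1, by positivity, fun t ht => ?_⟩
  have hg := hγ_pos t (by linarith [abs_nonneg S])
  obtain ⟨a, b⟩ := hS t (by linarith [le_abs_self S])
  rw [inv_div] at a b
  rw [div_lt_iff₀ hg] at a
  refine ⟨?_, a.le⟩
  have := (div_pos_iff_of_pos_right hg).1 b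
  exact (pos_of_mul_pos_right this hM.le).le

/-- `t = o(γ t)`. -/
lemma aux_lin (M : ℝ) (hM : 0 < M) (f φ γ : ℝ → ℝ) (L : ℝ) (hL : 1 < L)
    (hφ_inf : Tendsto φ atTop atTop)
    (hint : ∀ t ≥ 0, IntervalIntegrable (fun s => f (γ s)) volume 0 t)
    (hγ_pos : ∀ t > (0:ℝ), 0 < γ t)
    (hγ_inf : Tendsto γ atTop atTop)
    (hlow : ∃ S > 0, ∀ s ≥ S, φ (γ s) ≤ (1 + 1) * f (γ s))
    (hphi : ∃ S > 0, ∀ t ≥ S, 0 ≤ (∫ s in (0:ℝ)..t, f (γ s)) ∧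
      M * (∫ s in (0:ℝ)..t, f (γ s)) ≤ (1 / L + 1) * γ t)
    (δ : ℝ) (hδ : 0 < δ) : ∃ S > 0, ∀ t ≥ S, t ≤ δ * γ t + S := by
  obtain ⟨S1, hS1, h1⟩ := hlow
  obtain ⟨S2, hS2, h2⟩ := hphi
  set N := 2 / (M * δ) with hN
  have hN0 : 0 < N := by positivity
  obtain ⟨S3, h3⟩ := eventually_atTop.1 ((hφ_inf.comp hγ_inf).eventually_ge_atTop (2 * N))
  set S := max S1 (max S2 S3) with hS
  have a1 : S1 ≤ S := le_max_left _ _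
  have a2 : S2 ≤ S := (le_max_left _ _).trans (le_max_right _ _)
  have a3 : S3 ≤ S := (le_max_right _ _).trans (le_max_right _ _)
  have hS0 : 0 < S := by linarith
  refine ⟨S, hS0, fun t ht => ?_⟩
  have ht0 : 0 < t := by linarith
  have i2 : IntervalIntegrable (fun s => f (γ s)) volume S t :=
      (hint S hS0.le).symm.trans (hint t ht0.le)
  have hsplit := intervalIntegral.integral_add_adjacent_intervals (hint S hS0.le) i2
  have hle : ∫ s in S..t, N ≤ ∫ s in S..t, f (γ s) :=
      intervalIntegral.integral_mono_on ht (by simp) i2 (fun s hs => by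
        have b1 := h1 s (a1.trans hs.1)
        have b2 := h3 s (a3.trans hs.1)
        simp only [Function.comp] at b2
        linarith)
  rw [intervalIntegral.integral_const, smul_eq_mul] at hle
  have c1 := (h2 S a2).1
  have c2 := (h2 t (a2.trans ht)).2
  have hg := hγ_pos t ht0
  have hL1 : 1 / L ≤ 1 := by rw [div_le_one (by linarith)]; linarith
  have d1 : M * ((t - S) * N) ≤ 2 * γ t := by
    calc M * ((t - S) * N) ≤ M * ∫ s in (0:ℝ)..t, f (γ s) := by
          apply mul_le_mul_of_nonneg_left _ hM.le; linarith
      _ ≤ (1 / L + 1) * γ t := c2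
      _ ≤ 2 * γ t := by apply mul_le_mul_of_nonneg_right _ hg.le; linarith
  have d2 : M * ((t - S) * N) = 2 * ((t - S) / δ) := by rw [hN]; field_simp
  rw [d2] at d1
  have d3 : (t - S) / δ ≤ γ t := by linarith
  rw [div_le_iff₀ hδ] at d3
  linarith

lemma aux_fin (L : ℝ) (hL : 1 < L) (x γ : ℝ → ℝ)
    (hx_cont : ContinuousOn x (Set.Ici 0))
    (hγ_cont : ContinuousOn γ (Set.Ioi 0)) (hγ_pos : ∀ t > (0:ℝ), 0 < γ t)
    (hγ_mono : StrictMonoOn γ (Set.Ioi 0)) (hγ_inf : Tendsto γ atTop atTop)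
    (key : ∀ ε > 0, ∃ T0 > 0, ∀ T ≥ T0, ∃ A ≥ 0, ∀ K ≥ 1, ∀ t ≥ T,
      (∀ s, T ≤ s → s < t → |x s| ≤ K * γ s) →
      |x t| ≤ A + (1 + ε) * γ t + K * (1 / L + ε) * γ t) :
    Filter.limsup (fun t => ((|x t| / γ t : ℝ) : EReal)) atTop ≤ ((L / (L - 1) : ℝ) : EReal) := by
  have hL0 : 0 < L := by linarith
  have hL1 : 1 / L < 1 := by rw [div_lt_one hL0]; exact hL
  -- the set of admissible constants
  let E : Set ℝ := {K | 1 ≤ K ∧ ∀ᶠ t in atTop, |x t| ≤ K * γ t}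
  have hEne : E.Nonempty := by
    set ε := (1 - 1 / L) / 2 with hε
    have hε0 : 0 < ε := by rw [hε]; linarith
    obtain ⟨T, hT, h⟩ := key ε hε0
    obtain ⟨A, hA, h⟩ := h T le_rfl
    have hgT := hγ_pos T hT
    set K := (A / γ T + 1 + ε) / ε + 1 with hK
    have hK1 : 1 ≤ K := by
      have : 0 ≤ (A / γ T + 1 + ε) / ε := by positivity
      linarith
    have hstrict : ∀ t ≥ T, (∀ s, T ≤ s → s < t → |x s| ≤ K * γ s) → |x t| < K * γ t := by
      intro t ht hs
      have h1 := h K hK1 t ht hs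
      have hgt : γ T ≤ γ t := hγ_mono.monotoneOn hT (lt_of_lt_of_le hT ht) ht
      have hg0 : 0 < γ t := by linarith
      have hAle : A ≤ A / γ T * γ t := by
        calc A = A / γ T * γ T := by field_simp
          _ ≤ _ := by apply mul_le_mul_of_nonneg_left hgt; positivity
      have e1 : 1 / L + ε = 1 - ε := by rw [hε]; ring
      have e2 : K * ε = A / γ T + 1 + ε + ε := by rw [hK]; field_simp
      rw [e1] at h1
      have e3 : A / γ T * γ t + (1 + ε) * γ t + K * (1 - ε) * γ t = K * γ t - ε * γ t := by
        have : K * (1 - ε) = K - K * ε := by ring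
        rw [this, e2]; ring
      have : 0 < ε * γ t := by positivity
      linarith
    have hall : ∀ t ≥ T, |x t| < K * γ t := by
      by_contra hcon
      push Not at hcon
      let B : Set ℝ := {t ∈ Set.Ici T | K * γ t ≤ |x t|}
      have hBc : IsClosed B := by
        apply isClosed_Ici.isClosed_le
        · exact continuousOn_const.mul (hγ_cont.mono (fun s hs => lt_of_lt_of_le hT hs))
        · exact (hx_cont.mono (fun s hs => hT.le.trans hs)).abs
      have hBn : B.Nonempty := by
        obtain ⟨t, ht, ht'⟩ := hcon
        exact ⟨t, ht, ht'⟩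
      have hBb : BddBelow B := ⟨T, fun t ht => ht.1⟩
      have hm := hBc.csInf_mem hBn hBb
      have := hstrict (sInf B) hm.1 (fun s hs hlt => by
        by_contra hc
        push Not at hc
        exact absurd (csInf_le hBb (show s ∈ B from ⟨hs, hc.le⟩)) (not_le.2 hlt))
      exact absurd hm.2 (not_le.2 this)
    exact ⟨K, hK1, eventually_atTop.2 ⟨T, fun t ht => (hall t ht).le⟩⟩
  have hEb : BddBelow E := ⟨1, fun K hK => hK.1⟩
  have hboot : ∀ K ∈ E, ∀ ε > 0, 1 + K / L + ε ∈ E := by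
    intro K hK ε hε
    obtain ⟨hK1, hKe⟩ := hK
    have hK0 : 0 < K := by linarith
    refine ⟨by have : 0 ≤ K / L := by positivity
               linarith, ?_⟩
    set e := ε / (K + 2) with he
    have he0 : 0 < e := by positivity
    obtain ⟨T0, hT0, h⟩ := key e he0
    obtain ⟨T1, hT1⟩ := eventually_atTop.1 hKe
    obtain ⟨A, hA, h⟩ := h (max T0 T1) (le_max_left _ _)
    filter_upwards [eventually_ge_atTop (max T0 T1), hγ_inf.eventually_ge_atTop (A / e)]
      with t ht hAt
    have h1 := h K hK1 t ht (fun s hs _ => hT1 s ((le_max_right _ _).trans hs))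
    rw [div_le_iff₀ he0] at hAt
    have e2 : (K + 2) * e = ε := by rw [he]; field_simp
    calc |x t| ≤ γ t * e + (1 + e) * γ t + K * (1 / L + e) * γ t := by linarith
      _ = (1 + K / L + (K + 2) * e) * γ t := by ring
      _ = _ := by rw [e2]
  set K0 := sInf E with hK0
  have hK0le : K0 ≤ 1 + K0 / L := by
    apply le_of_forall_pos_le_add
    intro ε hε
    obtain ⟨K, hKE, hKlt⟩ := exists_lt_of_csInf_lt hEne (show sInf E < K0 + ε / 2 by linarith)
    have h1 := csInf_le hEb (hboot K hKE (ε / 2) (by linarith))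
    have h2 : K / L ≤ (K0 + ε / 2) / L := by gcongr
    have h3 : (ε / 2) / L ≤ ε / 2 := div_le_self (by linarith) hL.le
    rw [add_div] at h2
    linarith
  have hK0L : K0 ≤ L / (L - 1) := by
    rw [le_div_iff₀ (by linarith)]
    have : K0 * L ≤ (1 + K0 / L) * L := mul_le_mul_of_nonneg_right hK0le hL0.le
    have e : (1 + K0 / L) * L = L + K0 := by field_simp
    linarith
  apply EReal.le_of_forall_lt_iff_le.1
  intro b hb
  have hb' : L / (L - 1) < b := by exact_mod_cast hb
  obtain ⟨K, hKE, hKlt⟩ := exists_lt_of_csInf_lt hEne (show sInf E < b by linarith)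
  apply limsup_le_of_le
  · isBoundedDefault
  · filter_upwards [hKE.2, eventually_gt_atTop 0] with t ht ht0
    have hg := hγ_pos t ht0
    rw [EReal.coe_le_coe_iff, div_le_iff₀ hg]
    exact ht.trans (mul_le_mul_of_nonneg_right hKlt.le hg.le)

/-- Under (A1), (A2)+(A4) (`f : ℝ → ℝ` continuous with `|f(x)|/φ(|x|) → 1` as
`|x| → ∞` for a `C¹` function `φ` with `φ → ∞`, `φ' > 0`, `φ'` nonincreasing, `φ' → 0`),
(A±) (`H` continuous real-valued), and (F1) (`γ` continuous, increasing, `γ → ∞`,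
`limsup |H(t)|/γ(t) = 1`): if `γ(t)/(M ∫₀ᵗ f(γ(s)) ds) → L ∈ (1,∞)`, then
`limsup |x(t)|/γ(t) ≤ L/(L−1)`. -/
theorem stmt8 (μ : Measure ℝ) (M : ℝ) (hM : 0 < M)
    (hμ : μ Set.univ = ENNReal.ofReal M) (hμ0 : μ (Set.Iio 0) = 0)
    (f H x φ φd γ : ℝ → ℝ) (L : ℝ) (hL : 1 < L)
    (hf_cont : Continuous f)
    (hH_cont : ContinuousOn H (Set.Ici 0))
    (hx_cont : ContinuousOn x (Set.Ici 0))
    (heq : ∀ t ≥ (0:ℝ),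
      x t = x 0 + (∫ s in (0:ℝ)..t, (μ (Set.Icc 0 (t - s))).toReal * f (x s)) + H t)
    (hφ_deriv : ∀ y ≥ (0:ℝ), HasDerivAt φ (φd y) y)
    (hφd_cont : ContinuousOn φd (Set.Ici 0))
    (hφ_pos : ∀ y ≥ (0:ℝ), 0 < φ y)
    (hφ_inf : Tendsto φ atTop atTop)
    (hφd_pos : ∀ y ≥ (0:ℝ), 0 < φd y)
    (hφd_anti : AntitoneOn φd (Set.Ici 0))
    (hφd_zero : Tendsto φd atTop (nhds 0))
    (hfφ : Tendsto (fun y => |f y| / φ |y|) (Filter.cocompact ℝ) (nhds 1))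
    (hγ_cont : ContinuousOn γ (Set.Ioi 0)) (hγ_pos : ∀ t > (0:ℝ), 0 < γ t)
    (hγ_mono : StrictMonoOn γ (Set.Ioi 0)) (hγ_inf : Tendsto γ atTop atTop)
    (hHγ : Filter.limsup (fun t => ((|H t| / γ t : ℝ) : EReal)) atTop = 1)
    (hLγ : Tendsto (fun t => γ t / (M * ∫ s in (0:ℝ)..t, f (γ s))) atTop (nhds L)) :
    Filter.limsup (fun t => ((|x t| / γ t : ℝ) : EReal)) atTop ≤ ((L / (L - 1) : ℝ) : EReal) := by
  have hφ_mono := aux_mono φ φd hφ_deriv hφd_pos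
  have hint := aux_int f γ hf_cont hγ_cont hγ_pos hγ_mono
  have hlow := aux_lower M hM f φ γ L hL hf_cont hφ_pos hφ_mono hfφ hint hγ_pos hγ_inf hLγ
  have hphi := aux_phi M hM f γ L hL hγ_pos hLγ
  have hlin := aux_lin M hM f φ γ L hL hφ_inf hint hγ_pos hγ_inf (hlow 1 one_pos) (hphi 1 one_pos)
  apply aux_fin L hL x γ hx_cont hγ_cont hγ_pos hγ_mono hγ_inf
  have hL0 : 0 < L := by linarith
  have hL1 : 1 / L < 1 := by rw [div_lt_one hL0]; exact hL
  intro ε hε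
  set δ := min 1 (ε / 7) with hδ
  have hδ0 : 0 < δ := lt_min one_pos (by linarith)
  have hδ1 : δ ≤ 1 := min_le_left _ _
  have hδε : 7 * δ ≤ ε := by linarith [min_le_right 1 (ε / 7)]
  obtain ⟨C, hC, hup⟩ := aux_upper f φ hf_cont hφ_pos hfφ δ hδ0
  obtain ⟨S1, hS1, h1⟩ := hlow δ hδ0
  obtain ⟨S2, hS2, h2⟩ := hphi δ hδ0
  obtain ⟨S3, hS3, h3⟩ := hlin (δ / (M * C + 1)) (by positivity)
  have hHlt : Filter.limsup (fun t => ((|H t| / γ t : ℝ) : EReal)) atTop < ((1 + δ : ℝ) : EReal) := by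
    rw [hHγ]
    exact_mod_cast (show (1:ℝ) < 1 + δ by linarith)
  obtain ⟨S4, h4⟩ := eventually_atTop.1 (eventually_lt_of_limsup_lt hHlt)
  refine ⟨max S1 (max S2 (max S3 S4)), lt_max_of_lt_left hS1, fun T hT => ?_⟩
  simp only [ge_iff_le, max_le_iff] at hT
  obtain ⟨hT1, hT2, hT3, hT4⟩ := hT
  have hT0 : 0 < T := by linarith
  have hxi : ∀ a b, 0 ≤ a → 0 ≤ b → IntervalIntegrable (fun s => |f (x s)|) volume a b := by
    intro a b ha hb
    apply ContinuousOn.intervalIntegrable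
    apply ContinuousOn.abs
    apply hf_cont.comp_continuousOn
    apply hx_cont.mono
    intro s hs
    exact (le_min ha hb).trans hs.1
  set I := ∫ s in (0:ℝ)..T, |f (x s)| with hI
  have hI0 : 0 ≤ I := intervalIntegral.integral_nonneg hT0.le (fun s _ => abs_nonneg _)
  refine ⟨|x 0| + M * I + M * C * S3, by positivity, fun K hK t ht hs => ?_⟩
  have ht0 : 0 < t := by linarith
  have hg := hγ_pos t ht0
  have hμle : ∀ s, (μ (Set.Icc 0 s)).toReal ≤ M := by
    intro s
    have : μ (Set.Icc 0 s) ≤ ENNReal.ofReal M := hμ ▸ measure_mono (Set.subset_univ _)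
    exact ENNReal.toReal_le_of_le_ofReal hM.le this
  have hb1 : |∫ s in (0:ℝ)..t, (μ (Set.Icc 0 (t - s))).toReal * f (x s)|
      ≤ ∫ s in (0:ℝ)..t, M * |f (x s)| := by
    rw [← Real.norm_eq_abs]
    apply intervalIntegral.norm_integral_le_of_norm_le ht0.le
    · refine Eventually.of_forall fun s _ => ?_
      rw [norm_mul, Real.norm_eq_abs, Real.norm_eq_abs, abs_of_nonneg ENNReal.toReal_nonneg]
      exact mul_le_mul_of_nonneg_right (hμle _) (abs_nonneg _)
    · exact (hxi 0 t le_rfl ht0.le).const_mul M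
  rw [intervalIntegral.integral_const_mul,
    ← intervalIntegral.integral_add_adjacent_intervals (hxi 0 T le_rfl hT0.le)
      (hxi T t hT0.le ht0.le), ← hI] at hb1
  have iγ : IntervalIntegrable (fun s => f (γ s)) volume T t :=
      (hint T hT0.le).symm.trans (hint t ht0.le)
  have hsplit := intervalIntegral.integral_add_adjacent_intervals (hint T hT0.le) iγ
  have hb2 : ∫ s in T..t, |f (x s)| ≤ ∫ s in T..t, ((1 + δ) ^ 2 * K * f (γ s) + C) := by
    apply intervalIntegral.integral_mono_on_of_le_Ioo ht (hxi T t hT0.le ht0.le)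
    · exact (iγ.const_mul _).add (by simp)
    · intro s hsm
      have hgs := hγ_pos s (hT0.trans hsm.1)
      have b1 := hup (x s)
      have b2 : φ |x s| ≤ φ (K * γ s) := hφ_mono (Set.mem_Ici.2 (abs_nonneg _))
        (Set.mem_Ici.2 (by positivity)) (hs s hsm.1.le hsm.2)
      have b3 := aux_scale φ φd hφ_deriv hφ_pos hφd_anti K (γ s) hK hgs.le
      have b4 := h1 s (hT1.trans hsm.1.le)
      have b5 : φ |x s| ≤ K * ((1 + δ) * f (γ s)) :=
        b2.trans (b3.trans (mul_le_mul_of_nonneg_left b4 (by linarith)))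
      have b6 := mul_le_mul_of_nonneg_left b5 (show 0 ≤ 1 + δ by linarith)
      calc |f (x s)| ≤ (1 + δ) * (K * ((1 + δ) * f (γ s))) + C := by linarith
        _ = _ := by ring
  rw [intervalIntegral.integral_add (iγ.const_mul _) (by simp),
    intervalIntegral.integral_const_mul, intervalIntegral.integral_const, smul_eq_mul] at hb2
  have c1 := (h2 T hT2).1
  have c2 := (h2 t (hT2.trans ht)).2
  have c3 : M * ∫ s in T..t, f (γ s) ≤ (1 / L + δ) * γ t :=
    le_trans (mul_le_mul_of_nonneg_left (by linarith) hM.le) c2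
  have c4 : (1 + δ) ^ 2 * (1 / L + δ) ≤ 1 / L + ε := by
    have hl0 : 0 < 1 / L := by positivity
    have : (1 + δ) ^ 2 ≤ 1 + 3 * δ := by nlinarith
    calc (1 + δ) ^ 2 * (1 / L + δ) ≤ (1 + 3 * δ) * (1 / L + δ) := by gcongr
      _ ≤ 1 / L + ε := by nlinarith
  have c5 : M * ((1 + δ) ^ 2 * K * ∫ s in T..t, f (γ s)) ≤ K * (1 / L + ε) * γ t := by
    calc M * ((1 + δ) ^ 2 * K * ∫ s in T..t, f (γ s))
        = ((1 + δ) ^ 2 * K) * (M * ∫ s in T..t, f (γ s)) := by ring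
      _ ≤ ((1 + δ) ^ 2 * K) * ((1 / L + δ) * γ t) :=
        mul_le_mul_of_nonneg_left c3 (by positivity)
      _ = ((1 + δ) ^ 2 * (1 / L + δ)) * (K * γ t) := by ring
      _ ≤ (1 / L + ε) * (K * γ t) := mul_le_mul_of_nonneg_right c4 (by positivity)
      _ = _ := by ring
  have c6 : M * ((t - T) * C) ≤ δ * γ t + M * C * S3 := by
    have d1 := h3 t (hT3.trans ht)
    have d2 : M * C * (δ / (M * C + 1)) ≤ δ := by
      rw [mul_div_assoc', div_le_iff₀ (by positivity)]
      nlinarith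
    have hMC : 0 ≤ M * C := by positivity
    calc M * ((t - T) * C) = M * C * t - M * C * T := by ring
      _ ≤ M * C * t := by linarith [mul_nonneg hMC hT0.le]
      _ ≤ M * C * (δ / (M * C + 1) * γ t + S3) := mul_le_mul_of_nonneg_left d1 hMC
      _ = M * C * (δ / (M * C + 1)) * γ t + M * C * S3 := by ring
      _ ≤ _ := by linarith [mul_le_mul_of_nonneg_right d2 hg.le]
  have c7 : |H t| ≤ (1 + δ) * γ t := by
    have := h4 t (hT4.trans ht)
    rw [EReal.coe_lt_coe_iff, div_lt_iff₀ hg] at this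
    exact this.le
  have c8 := mul_le_mul_of_nonneg_left hb2 hM.le
  have c9 : |x t| ≤ |x 0| + |∫ s in (0:ℝ)..t, (μ (Set.Icc 0 (t - s))).toReal * f (x s)| + |H t| := by
    rw [heq t ht0.le]
    exact (abs_add_le _ _).trans (add_le_add (abs_add_le _ _) le_rfl)
  have c10 : 2 * δ * γ t ≤ ε * γ t := mul_le_mul_of_nonneg_right (by linarith) hg.le
  rw [mul_add] at hb1 c8
  linarith
end

section
/- Assume (A1), (A2) with (A4), (A±), and (F1): γ : (0,∞) → (0,∞) is continuous, increasing, γ(t) → ∞ as t → ∞, and limsup_{t→∞} |H(t)|/γ(t) = 1. If γ(t)/(M ∫₀ᵗ f(γ(s)) ds) → ∞ as t → ∞ (that is, L_f(γ) = ∞), then limsup_{t→∞} |x(t)|/γ(t) = 1 and (x(t) − H(t))/γ(t) → 0 as t → ∞. -/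
open Filter MeasureTheory

theorem aux_limsup (u v : ℝ → ℝ) (h : Tendsto (fun t => u t - v t) atTop (nhds 0)) :
    Filter.limsup (fun t => ((u t : ℝ) : EReal)) atTop
      ≤ Filter.limsup (fun t => ((v t : ℝ) : EReal)) atTop := by
  have h0 : Filter.limsup (fun t => ((u t - v t : ℝ) : EReal)) atTop = 0 := by
    apply Tendsto.limsup_eq
    exact_mod_cast (continuous_coe_real_ereal.tendsto 0).comp h
  have e : (fun t => ((u t : ℝ) : EReal))
      = (fun t => ((u t - v t : ℝ) : EReal)) + (fun t => ((v t : ℝ) : EReal)) := by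
    funext t
    simp only [Pi.add_apply]
    rw [← EReal.coe_add]
    simp
  rw [e]
  refine (EReal.limsup_add_le ?_ ?_).trans ?_
  · left; rw [h0]; simp
  · left; rw [h0]; simp
  · rw [h0, zero_add]

theorem aux_phi_s9 (φ φd : ℝ → ℝ)
    (hφ_deriv : ∀ y ≥ (0:ℝ), HasDerivAt φ (φd y) y)
    (hφ_pos : ∀ y ≥ (0:ℝ), 0 < φ y)
    (hφd_pos : ∀ y ≥ (0:ℝ), 0 < φd y)
    (hφd_anti : AntitoneOn φd (Set.Ici 0)) :
    MonotoneOn φ (Set.Ici 0) ∧ ∀ K ≥ (1:ℝ), ∀ y ≥ (0:ℝ), φ (K * y) ≤ K * φ y := by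
  have hc : ContinuousOn φ (Set.Ici 0) := fun y hy =>
    (hφ_deriv y hy).continuousAt.continuousWithinAt
  have hd : DifferentiableOn ℝ φ (interior (Set.Ici 0)) := fun y hy =>
    (hφ_deriv y (interior_subset hy)).differentiableAt.differentiableWithinAt
  constructor
  · apply monotoneOn_of_deriv_nonneg (convex_Ici 0) hc hd
    intro y hy
    rw [(hφ_deriv y (interior_subset hy)).deriv]
    exact (hφd_pos y (interior_subset hy)).le
  · have hcc : ConcaveOn ℝ (Set.Ici 0) φ := by
      apply AntitoneOn.concaveOn_of_deriv (convex_Ici 0) hc hd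
      intro a ha b hb hab
      rw [(hφ_deriv a (interior_subset ha)).deriv, (hφ_deriv b (interior_subset hb)).deriv]
      exact hφd_anti (interior_subset ha) (interior_subset hb) hab
    intro K hK y hy
    have hK0 : 0 < K := by linarith
    have hi : 0 ≤ 1 - K⁻¹ := by
      have := inv_le_one_of_one_le₀ hK
      linarith
    have h := hcc.2 (show K * y ∈ Set.Ici 0 from mul_nonneg hK0.le hy)
      (show (0:ℝ) ∈ Set.Ici 0 from Set.mem_Ici.2 le_rfl) (inv_nonneg.2 hK0.le) hi (by ring)
    simp only [smul_eq_mul, mul_zero, add_zero] at h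
    rw [inv_mul_cancel_left₀ hK0.ne'] at h
    have h2 : K⁻¹ * φ (K * y) ≤ φ y := by
      have := mul_nonneg hi (hφ_pos 0 le_rfl).le
      linarith
    rwa [inv_mul_le_iff₀ hK0] at h2

theorem aux_bound (f φ : ℝ → ℝ) (hf : Continuous f) (hφ : Continuous fun y => φ |y|)
    (hpos : ∀ y, 0 < φ |y|)
    (hfφ : Tendsto (fun y => |f y| / φ |y|) (Filter.cocompact ℝ) (nhds 1)) :
    ∃ C > 0, ∀ y, |f y| ≤ C * φ |y| := by
  have h1 : ∀ᶠ y in Filter.cocompact ℝ, |f y| / φ |y| < 2 :=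
    hfφ.eventually (gt_mem_nhds (by norm_num))
  obtain ⟨S, hS, hS2⟩ := Filter.mem_cocompact.1 h1
  obtain ⟨C, hC⟩ := hS.exists_bound_of_continuousOn
    (f := fun y => |f y| / φ |y|) ((hf.abs.div hφ fun y => (hpos y).ne').continuousOn)
  refine ⟨max C 2, by positivity, fun y => ?_⟩
  rw [← div_le_iff₀ (hpos y)]
  by_cases hy : y ∈ S
  · exact ((le_abs_self _).trans (hC y hy)).trans (le_max_left _ _)
  · exact (le_of_lt (hS2 hy)).trans (le_max_right _ _)

theorem aux_P (M : ℝ) (hM : 0 < M) (f φ γ h : ℝ → ℝ) (hf : Continuous f)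
    (hfφ : Tendsto (fun y => |f y| / φ |y|) (Filter.cocompact ℝ) (nhds 1))
    (hφpos : ∀ y ≥ (0:ℝ), 0 < φ y)
    (hφm : MonotoneOn φ (Set.Ici 0))
    (hγ_cont : ContinuousOn γ (Set.Ioi 0)) (hγ_pos : ∀ t > (0:ℝ), 0 < γ t)
    (hγ_mono : StrictMonoOn γ (Set.Ioi 0)) (hγ_inf : Tendsto γ atTop atTop)
    (hLγ : Tendsto (fun t => γ t / (M * ∫ s in (0:ℝ)..t, f (γ s))) atTop atTop)
    (hh : Continuous h) (hhγ : ∀ t ≥ 1, h t = φ (γ t)) :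
    ∀ N > (0:ℝ), ∀ᶠ t in atTop, N * (1 + ∫ s in (1:ℝ)..t, h s) ≤ γ t := by
  -- integrability of f ∘ γ on [0,T]
  have hint : ∀ T > (0:ℝ), IntervalIntegrable (fun s => f (γ s)) volume 0 T := by
    intro T hT
    obtain ⟨C, hC⟩ := (isCompact_Icc (a := (0:ℝ)) (b := γ T)).exists_bound_of_continuousOn
      hf.continuousOn
    rw [intervalIntegrable_iff_integrableOn_Ioc_of_le hT.le]
    refine (integrable_const C).mono' ?_ ?_
    · exact (hf.comp_continuousOn (hγ_cont.mono fun s hs => hs.1)).aestronglyMeasurable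
        measurableSet_Ioc
    · refine (ae_restrict_iff' measurableSet_Ioc).2 (ae_of_all _ fun s hs => ?_)
      exact hC _ ⟨(hγ_pos s hs.1).le, hγ_mono.monotoneOn hs.1 hT hs.2⟩
  have h1 : ∀ᶠ t in atTop, 1 / 2 < |f (γ t)| / φ |γ t| := by
    have : Tendsto γ atTop (Filter.cocompact ℝ) :=
      hγ_inf.mono_right atTop_le_cocompact
    exact (hfφ.comp this).eventually (lt_mem_nhds (by norm_num))
  obtain ⟨T0, hT0⟩ := eventually_atTop.1 h1
  set T := max T0 1 with hTdef
  have hT1 : 1 ≤ T := le_max_right _ _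
  have hhm : ∀ t ≥ 1, ∀ s ≥ t, h t ≤ h s := by
    intro t ht s hs
    rw [hhγ t ht, hhγ s (ht.trans hs)]
    have ht0 : 0 < t := by linarith
    have hs0 : 0 < s := by linarith
    exact hφm (hγ_pos t ht0).le (hγ_pos s hs0).le (hγ_mono.monotoneOn ht0 hs0 hs)
  have hh1 : 0 < h 1 := by
    rw [hhγ 1 le_rfl]; exact hφpos _ (hγ_pos 1 one_pos).le
  have hfg : ∀ t ≥ T, h t / 2 ≤ |f (γ t)| := by
    intro t ht
    have ht1 : 1 ≤ t := hT1.trans ht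
    have hp := hγ_pos t (by linarith)
    have := hT0 t ((le_max_left _ _).trans ht)
    rw [abs_of_pos hp, lt_div_iff₀ (hφpos _ hp.le), ← hhγ t ht1] at this
    linarith
  have hgrow : ∀ a ≥ 1, ∀ t ≥ a, h 1 * (t - a) ≤ ∫ s in a..t, h s := by
    intro a ha t ht
    have : ∫ s in a..t, h 1 ≤ ∫ s in a..t, h s := by
      apply intervalIntegral.integral_mono_on ht (by simp) (hh.intervalIntegrable _ _)
      intro s hs
      exact hhm 1 le_rfl s (ha.trans hs.1)
    simpa [mul_comm] using this
  have hPinf : Tendsto (fun t => ∫ s in (1:ℝ)..t, h s) atTop atTop := by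
    refine tendsto_atTop_mono' _ ?_
      ((tendsto_atTop_add_const_right atTop (-1:ℝ) tendsto_id).const_mul_atTop hh1)
    filter_upwards [eventually_ge_atTop 1] with t ht
    exact hgrow 1 le_rfl t ht
  -- sign
  have hsplit : ∀ t ≥ T, ∫ s in (0:ℝ)..t, f (γ s)
      = (∫ s in (0:ℝ)..T, f (γ s)) + ∫ s in T..t, f (γ s) := by
    intro t ht
    have a := hint T (by linarith)
    have b := hint t (by linarith)
    exact (intervalIntegral.integral_add_adjacent_intervals a (a.symm.trans b)).symm
  have hintT : ∀ t ≥ T, IntervalIntegrable (fun s => f (γ s)) volume T t := by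
    intro t ht
    exact (hint T (by linarith)).symm.trans (hint t (by linarith))
  have hPsplit : ∀ t, ∫ s in T..t, h s = (∫ s in (1:ℝ)..t, h s) - ∫ s in (1:ℝ)..T, h s := by
    intro t
    rw [eq_sub_iff_add_eq, add_comm]
    exact intervalIntegral.integral_add_adjacent_intervals (hh.intervalIntegrable _ _)
      (hh.intervalIntegrable _ _)
  have hpos : ∀ t ≥ T, 0 < h t := fun t ht => hh1.trans_le (hhm 1 le_rfl t (hT1.trans ht))
  have hsign : (∀ t ≥ T, h t / 2 ≤ f (γ t)) ∨ (∀ t ≥ T, f (γ t) ≤ - (h t / 2)) := by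
    have hcon : ContinuousOn (fun t => f (γ t)) (Set.Ici T) :=
      hf.comp_continuousOn (hγ_cont.mono fun s hs => by
        have : T ≤ s := hs
        exact Set.mem_Ioi.2 (by linarith))
    by_contra hcn
    push Not at hcn
    obtain ⟨⟨a, ha, ha2⟩, b, hb, hb2⟩ := hcn
    have h3 := hfg a ha
    have h4 := hfg b hb
    have h5 := hpos a ha
    have h6 := hpos b hb
    have ha3 : f (γ a) ≤ 0 := by
      by_contra hc
      rw [abs_of_pos (not_le.1 hc)] at h3; linarith
    have hb3 : 0 ≤ f (γ b) := by
      by_contra hc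
      rw [abs_of_neg (not_le.1 hc)] at h4; linarith
    obtain ⟨c, hc, hc2⟩ := (isPreconnected_Ici (a := T)).intermediate_value ha hb hcon
      (show (0:ℝ) ∈ Set.Icc _ _ from ⟨ha3, hb3⟩)
    have h7 := hfg c hc
    have h8 := hpos c hc
    simp only at hc2
    rw [hc2, abs_zero] at h7
    linarith
  intro N hN
  rcases hsign with hs | hs
  · have e1 := hLγ.eventually_ge_atTop (4 * N / M)
    have e2 := hPinf.eventually_ge_atTop
      (4 * (1 / 4 - (∫ s in (0:ℝ)..T, f (γ s)) + (∫ s in (1:ℝ)..T, h s) / 2))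
    filter_upwards [e1, e2, eventually_ge_atTop T, hPinf.eventually_ge_atTop 0] with t h1 h2 ht h0
    have h3 : (∫ s in T..t, h s / 2) ≤ ∫ s in T..t, f (γ s) :=
      intervalIntegral.integral_mono_on ht ((hh.div_const 2).intervalIntegrable _ _)
        (hintT t ht) (fun s hs' => hs s hs'.1)
    rw [intervalIntegral.integral_div, hPsplit] at h3
    have h4 := hsplit t ht
    have h5 : (1 + ∫ s in (1:ℝ)..t, h s) / 4 ≤ ∫ s in (0:ℝ)..t, f (γ s) := by
      rw [h4]; linarith
    have h6 : 0 < ∫ s in (0:ℝ)..t, f (γ s) := by linarith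
    rw [le_div_iff₀ (mul_pos hM h6)] at h1
    have h7 : 4 * N / M * (M * ∫ s in (0:ℝ)..t, f (γ s)) = 4 * N * ∫ s in (0:ℝ)..t, f (γ s) := by
      field_simp
    rw [h7] at h1
    nlinarith
  · exfalso
    have e1 := hLγ.eventually_gt_atTop 0
    have e2 := hPinf.eventually_ge_atTop
      (2 * ((∫ s in (0:ℝ)..T, f (γ s)) + (∫ s in (1:ℝ)..T, h s) / 2))
    obtain ⟨t, h1, h2, ht⟩ := (e1.and (e2.and (eventually_ge_atTop T))).exists
    have h3 : (∫ s in T..t, f (γ s)) ≤ (∫ s in T..t, -(h s / 2)) :=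
      intervalIntegral.integral_mono_on ht 
        (hintT t ht) ((hh.div_const 2).neg.intervalIntegrable _ _) (fun s hs' => hs s hs'.1)
    rw [intervalIntegral.integral_neg, intervalIntegral.integral_div, hPsplit] at h3
    have h4 := hsplit t ht
    have h5 : ∫ s in (0:ℝ)..t, f (γ s) ≤ 0 := by rw [h4]; linarith
    have h6 := div_nonpos_of_nonneg_of_nonpos (hγ_pos t (by linarith)).le
      (mul_nonpos_of_nonneg_of_nonpos hM.le h5)
    linarith

/-- Under (A1), (A2)+(A4), (A±), and (F1) (`γ` continuous, increasing,
`γ → ∞`, `limsup |H(t)|/γ(t) = 1`): if `γ(t)/(M ∫₀ᵗ f(γ(s)) ds) → ∞`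
(i.e. `L_f(γ) = ∞`), then `limsup |x(t)|/γ(t) = 1` and `(x(t) − H(t))/γ(t) → 0`. -/
theorem stmt9 (μ : Measure ℝ) (M : ℝ) (hM : 0 < M)
    (hμ : μ Set.univ = ENNReal.ofReal M) (hμ0 : μ (Set.Iio 0) = 0)
    (f H x φ φd γ : ℝ → ℝ)
    (hf_cont : Continuous f)
    (hH_cont : ContinuousOn H (Set.Ici 0))
    (hx_cont : ContinuousOn x (Set.Ici 0))
    (heq : ∀ t ≥ (0:ℝ),
      x t = x 0 + (∫ s in (0:ℝ)..t, (μ (Set.Icc 0 (t - s))).toReal * f (x s)) + H t)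
    (hφ_deriv : ∀ y ≥ (0:ℝ), HasDerivAt φ (φd y) y)
    (hφd_cont : ContinuousOn φd (Set.Ici 0))
    (hφ_pos : ∀ y ≥ (0:ℝ), 0 < φ y)
    (hφ_inf : Tendsto φ atTop atTop)
    (hφd_pos : ∀ y ≥ (0:ℝ), 0 < φd y)
    (hφd_anti : AntitoneOn φd (Set.Ici 0))
    (hφd_zero : Tendsto φd atTop (nhds 0))
    (hfφ : Tendsto (fun y => |f y| / φ |y|) (Filter.cocompact ℝ) (nhds 1))
    (hγ_cont : ContinuousOn γ (Set.Ioi 0)) (hγ_pos : ∀ t > (0:ℝ), 0 < γ t)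
    (hγ_mono : StrictMonoOn γ (Set.Ioi 0)) (hγ_inf : Tendsto γ atTop atTop)
    (hHγ : Filter.limsup (fun t => ((|H t| / γ t : ℝ) : EReal)) atTop = 1)
    (hLγ : Tendsto (fun t => γ t / (M * ∫ s in (0:ℝ)..t, f (γ s))) atTop atTop) :
    Filter.limsup (fun t => ((|x t| / γ t : ℝ) : EReal)) atTop = 1 ∧
    Tendsto (fun t => (x t - H t) / γ t) atTop (nhds 0) := by
  obtain ⟨hφm, hφK⟩ := aux_phi_s9 φ φd hφ_deriv hφ_pos hφd_pos hφd_anti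
  have hφc : Continuous fun y => φ |y| := by
    rw [continuous_iff_continuousAt]
    intro y
    exact ContinuousAt.comp (f := fun y : ℝ => |y|) (g := φ)
      (hφ_deriv |y| (abs_nonneg y)).continuousAt continuous_abs.continuousAt
  obtain ⟨C, hC, hfC⟩ := aux_bound f φ hf_cont hφc (fun y => hφ_pos _ (abs_nonneg y)) hfφ
  set xe : ℝ → ℝ := fun t => x (max t 0) with hxe
  have hxec : Continuous xe := by
    apply hx_cont.comp_continuous (by fun_prop)
    intro t; exact Set.mem_Ici.2 (le_max_right t 0)
  have hxx : ∀ t ≥ 0, xe t = x t := fun t ht => by simp [hxe, max_eq_left ht]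
  set h : ℝ → ℝ := fun t => φ |γ (max t 1)| with hhdef
  have hhc : Continuous h := by
    refine hφc.comp (hγ_cont.comp_continuous (by fun_prop) ?_)
    intro t; exact lt_of_lt_of_le one_pos (le_max_right t 1)
  have hhγ : ∀ t ≥ 1, h t = φ (γ t) := fun t ht => by
    simp only [hhdef, max_eq_left ht]
    rw [abs_of_pos (hγ_pos t (by linarith))]
  have hP := aux_P M hM f φ γ h hf_cont hfφ hφ_pos hφm hγ_cont hγ_pos hγ_mono hγ_inf hLγ hhc hhγ
  have hhpos : ∀ t, 0 < h t := fun t => hφ_pos _ (abs_nonneg _)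
  set g : ℝ → ℝ := fun t => φ |xe t| with hg
  have hgc : Continuous g := hφc.comp hxec
  set c := M * C with hc
  have hc0 : 0 < c := mul_pos hM hC
  -- bound on the integral
  have hI : ∀ t ≥ 0, |x t - x 0 - H t| ≤ c * ∫ s in (0:ℝ)..t, g s := by
    intro t ht
    have e : x t - x 0 - H t
        = ∫ s in (0:ℝ)..t, (μ (Set.Icc 0 (t - s))).toReal * f (x s) := by
      have := heq t ht; linarith
    rw [e, ← intervalIntegral.integral_const_mul, ← Real.norm_eq_abs]
    refine intervalIntegral.norm_integral_le_of_norm_le ht (ae_of_all _ fun s hs => ?_)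
      ((hgc.const_mul c).intervalIntegrable _ _)
    rw [norm_mul, Real.norm_eq_abs, Real.norm_eq_abs, abs_of_nonneg ENNReal.toReal_nonneg]
    have h1 : (μ (Set.Icc 0 (t - s))).toReal ≤ M := by
      apply ENNReal.toReal_le_of_le_ofReal hM.le
      rw [← hμ]; exact measure_mono (Set.subset_univ _)
    have h2 := hfC (x s)
    have h3 : g s = φ |x s| := by simp only [hg]; rw [hxx s hs.1.le]
    rw [h3, hc, mul_assoc]
    exact mul_le_mul h1 h2 (abs_nonneg _) hM.le
  have hH2 : ∀ᶠ t in atTop, |H t| / γ t < 2 := by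
    have : Filter.limsup (fun t => ((|H t| / γ t : ℝ) : EReal)) atTop < ((2:ℝ) : EReal) := by
      rw [hHγ]; exact_mod_cast (by norm_num : (1:ℝ) < 2)
    filter_upwards [eventually_lt_of_limsup_lt this] with t ht
    exact_mod_cast ht
  obtain ⟨T0, hT0⟩ := eventually_atTop.1 (hH2.and ((hP (4 * c) (by linarith)).and
    (hγ_inf.eventually_ge_atTop 1)))
  set T := max T0 1 with hT
  have hT1 : 1 ≤ T := le_max_right _ _
  have hTT : T0 ≤ T := le_max_left _ _
  set A := |x 0| + c * ∫ s in (0:ℝ)..T, g s with hA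
  have hgpos : ∀ t, 0 < g t := fun t => hφ_pos _ (abs_nonneg _)
  have hA0 : 0 ≤ A := by
    have : 0 ≤ ∫ s in (0:ℝ)..T, g s :=
      intervalIntegral.integral_nonneg (by linarith) fun s _ => (hgpos s).le
    positivity
  have hsub : ∀ t ≥ T, |x t - H t| ≤ A + c * ∫ s in T..t, g s := by
    intro t ht
    have h1 := hI t (by linarith)
    rw [← intervalIntegral.integral_add_adjacent_intervals (hgc.intervalIntegrable 0 T)
      (hgc.intervalIntegrable T t)] at h1
    have h2 : |x t - H t| ≤ |x 0| + |x t - x 0 - H t| := by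
      have := abs_add_le (x 0) (x t - x 0 - H t)
      ring_nf at this ⊢
      exact this
    rw [hA]; linarith
  set K := 2 * A + 4 with hK
  have hP0 : ∀ t ≥ 1, 0 ≤ ∫ s in (1:ℝ)..t, h s := fun t ht =>
    intervalIntegral.integral_nonneg ht fun s _ => (hhpos s).le
  have hJ : ∀ b ≥ T, ∫ s in T..b, g s ≤ K * (1 + ∫ s in (1:ℝ)..b, h s) := by
    intro b hb
    have hd1 : ∀ t, HasDerivAt (fun t => ∫ s in T..t, g s) (g t) t := fun t =>
      (hgc.integral_hasStrictDerivAt T t).hasDerivAt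
    have hd2 : ∀ t, HasDerivAt (fun t => K * (1 + ∫ s in (1:ℝ)..t, h s)) (K * h t) t := fun t =>
      (((hhc.integral_hasStrictDerivAt 1 t).hasDerivAt).const_add 1).const_mul K
    refine image_le_of_deriv_right_lt_deriv_boundary (a := T) (b := b)
      (f := fun t => ∫ s in T..t, g s) (f' := g)
      (B := fun t => K * (1 + ∫ s in (1:ℝ)..t, h s)) (B' := fun t => K * h t)
      (fun t _ => (hd1 t).continuousAt.continuousWithinAt)
      (fun t _ => (hd1 t).hasDerivWithinAt) ?_ hd2 ?_ ⟨hb, le_rfl⟩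
    · simp only [intervalIntegral.integral_same]
      have := hP0 T hT1
      positivity
    · intro t ht hte
      have htT : T ≤ t := ht.1
      obtain ⟨q1, q2, q3⟩ := hT0 t (hTT.trans htT)
      have hγp := hγ_pos t (by linarith)
      rw [div_lt_iff₀ hγp] at q1
      have hx1 := hsub t htT
      rw [hte] at hx1
      have hx2 : |x t| ≤ |x t - H t| + |H t| := by
        have := abs_add_le (x t - H t) (H t)
        simpa using this
      have hK0 : 0 < K := by linarith
      have hx3 : |x t| ≤ (A + 2 + K / 4) * γ t := by
        have : c * (K * (1 + ∫ s in (1:ℝ)..t, h s)) ≤ K / 4 * γ t := by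
          have := mul_le_mul_of_nonneg_left q2 (by positivity : 0 ≤ K / 4)
          linarith
        nlinarith
      have h3 : g t = φ |x t| := by simp only [hg]; rw [hxx t (by linarith)]
      have h4 : g t ≤ (A + 2 + K / 4) * φ (γ t) := by
        rw [h3]
        refine (hφm (Set.mem_Ici.2 (abs_nonneg _)) (Set.mem_Ici.2 ((abs_nonneg _).trans hx3)) hx3).trans ?_
        exact hφK _ (by linarith) _ hγp.le
      rw [← hhγ t (by linarith)] at h4
      have := hhpos t
      show g t < K * h t
      refine h4.trans_lt (mul_lt_mul_of_pos_right (by linarith) this)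
  have hconv : Tendsto (fun t => (x t - H t) / γ t) atTop (nhds 0) := by
    rw [Metric.tendsto_nhds]
    intro ε hε
    have hK0 : 0 < K := by linarith
    filter_upwards [hP ((A + c * K + 1) / ε * 2) (by positivity), eventually_ge_atTop T] with t h1 ht
    have hγp := hγ_pos t (by linarith)
    rw [Real.dist_eq, sub_zero, abs_div, abs_of_pos hγp, div_lt_iff₀ hγp]
    have h2 := hsub t ht
    have h3 := mul_le_mul_of_nonneg_left (hJ t ht) hc0.le
    have h4 := hP0 t (by linarith)
    have h5 := mul_le_mul_of_nonneg_left h1 hε.le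
    have h6 : ε * ((A + c * K + 1) / ε * 2 * (1 + ∫ s in (1:ℝ)..t, h s))
        = 2 * ((A + c * K + 1) * (1 + ∫ s in (1:ℝ)..t, h s)) := by
      field_simp
    rw [h6] at h5
    have : 0 ≤ A * ∫ s in (1:ℝ)..t, h s := mul_nonneg hA0 h4
    have : 0 ≤ c * K * ∫ s in (1:ℝ)..t, h s := mul_nonneg (by positivity) h4
    have : 0 < c * K := by positivity
    linarith
  refine ⟨?_, hconv⟩
  have hd : Tendsto (fun t => |x t| / γ t - |H t| / γ t) atTop (nhds 0) := by
    refine squeeze_zero_norm' (a := fun t => |(x t - H t) / γ t|) ?_ (by simpa using hconv.abs)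
    filter_upwards [eventually_ge_atTop 1] with t ht
    have hγp := hγ_pos t (by linarith)
    rw [← sub_div, Real.norm_eq_abs, abs_div, abs_div]
    exact div_le_div_of_nonneg_right (abs_abs_sub_abs_le _ _) (abs_nonneg _)
  have hd' : Tendsto (fun t => |H t| / γ t - |x t| / γ t) atTop (nhds 0) := by
    simpa using hd.neg
  apply le_antisymm
  · rw [← hHγ]; exact aux_limsup _ _ hd
  · rw [← hHγ]; exact aux_limsup _ _ hd'
end

section
/- Assume (A1), (A2) with (A4), and (A±). Let γ₊, γ₋ : (0,∞) → (0,∞) be continuous increasing functions with γ₊(t) → ∞ and γ₋(t) → ∞, such that limsup_{t→∞} |H(t)|/γ₊(t) = 0 and limsup_{t→∞} |H(t)|/γ₋(t) = ∞ (hypothesis (F2)). If γ₊(t)/(M ∫₀ᵗ f(γ₊(s)) ds) → L₊ with L₊ ∈ (1,∞), and γ₋(t)/(M ∫₀ᵗ f(γ₋(s)) ds) tends either to a limit in (1,∞) or to ∞, then limsup_{t→∞} |x(t)|/γ₊(t) ≤ 1/L₊ and limsup_{t→∞} |x(t)|/γ₋(t) = ∞. -/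
open Filter MeasureTheory

lemma aux_f_bound (f φ φd : ℝ → ℝ) (hf_cont : Continuous f)
    (hφ_deriv : ∀ y ≥ (0:ℝ), HasDerivAt φ (φd y) y)
    (hφ_pos : ∀ y ≥ (0:ℝ), 0 < φ y)
    (hφ_inf : Tendsto φ atTop atTop)
    (hφd_pos : ∀ y ≥ (0:ℝ), 0 < φd y)
    (hφd_anti : AntitoneOn φd (Set.Ici 0))
    (hfφ : Tendsto (fun y => |f y| / φ |y|) (Filter.cocompact ℝ) (nhds 1))
    (hfpos : ∀ᶠ y in atTop, 0 < f y) (ε : ℝ) (hε : 0 < ε) :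
    ∀ᶠ z in atTop, 0 < f z ∧ ∀ Λ ≥ (1:ℝ), ∀ y, |y| ≤ Λ * z → |f y| ≤ (1 + ε) * Λ * f z := by
  have hcont : ContinuousOn φ (Set.Ici 0) := fun y hy => (hφ_deriv y hy).continuousAt.continuousWithinAt
  have hmono : MonotoneOn φ (Set.Ici 0) := by
    apply monotoneOn_of_deriv_nonneg (convex_Ici 0) hcont
    · intro y hy
      rw [interior_Ici] at hy
      exact (hφ_deriv y (le_of_lt hy)).differentiableAt.differentiableWithinAt
    · intro y hy
      rw [interior_Ici] at hy
      rw [(hφ_deriv y (le_of_lt hy)).deriv]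
      exact (hφd_pos y (le_of_lt hy)).le
  have hconc : ConcaveOn ℝ (Set.Ici 0) φ := by
    apply AntitoneOn.concaveOn_of_deriv (convex_Ici 0) hcont
    · intro y hy
      rw [interior_Ici] at hy
      exact (hφ_deriv y (le_of_lt hy)).differentiableAt.differentiableWithinAt
    · rw [interior_Ici]
      intro a ha b hb hab
      rw [(hφ_deriv a (le_of_lt ha)).deriv, (hφ_deriv b (le_of_lt hb)).deriv]
      exact hφd_anti (Set.Ioi_subset_Ici_self ha) (Set.Ioi_subset_Ici_self hb) hab
  have hsub : ∀ Λ ≥ (1:ℝ), ∀ z ≥ (0:ℝ), φ (Λ * z) ≤ Λ * φ z := by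
    intro Λ hΛ z hz
    have hΛ0 : 0 < Λ := by linarith
    have h1 : 0 ≤ 1 - Λ⁻¹ := by
      have := inv_le_one_of_one_le₀ hΛ
      linarith
    have hm1 : Λ * z ∈ Set.Ici (0:ℝ) := by simp only [Set.mem_Ici]; positivity
    have hm2 : (0:ℝ) ∈ Set.Ici (0:ℝ) := by simp
    have h2 := hconc.2 hm1 hm2 (show 0 ≤ Λ⁻¹ by positivity) h1 (by ring)
    simp only [smul_eq_mul, mul_zero, add_zero] at h2
    rw [inv_mul_cancel_left₀ hΛ0.ne'] at h2
    have h3 : Λ⁻¹ * φ (Λ * z) ≤ φ z := by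
      have := mul_nonneg h1 (hφ_pos 0 le_rfl).le
      linarith
    rwa [inv_mul_le_iff₀ hΛ0] at h3
  obtain ⟨η, hη, hη1, hηε⟩ : ∃ η : ℝ, 0 < η ∧ η ≤ 1 ∧ 4 * η ≤ ε :=
    ⟨min 1 (ε / 4), by positivity, min_le_left _ _, by
      have := min_le_right 1 (ε / 4); linarith⟩
  -- global bound
  obtain ⟨C, hC⟩ : ∃ C : ℝ, ∀ y, |f y| ≤ C + (1 + η) * φ |y| := by
    have h1 := hfφ.eventually (gt_mem_nhds (show (1:ℝ) < 1 + η by linarith))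
    obtain ⟨K, hK, hKs⟩ := Filter.mem_cocompact.1 h1
    obtain ⟨C, hC⟩ := hK.exists_bound_of_continuousOn hf_cont.continuousOn
    refine ⟨max C 0, fun y => ?_⟩
    have hp := hφ_pos |y| (abs_nonneg y)
    by_cases hy : y ∈ K
    · have := hC y hy
      rw [Real.norm_eq_abs] at this
      have h3 : 0 < (1 + η) * φ |y| := by positivity
      have := le_max_left C 0
      linarith
    · have := hKs hy
      simp only [Set.mem_ofPred_eq] at this
      rw [div_lt_iff₀ hp] at this
      have := le_max_right C 0
      linarith
  have hlow : ∀ᶠ z in atTop, φ z ≤ (1 + η) * f z := by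
    have h2 : (1 + η)⁻¹ < 1 := inv_lt_one_of_one_lt₀ (by linarith)
    have h1 := (hfφ.mono_left atTop_le_cocompact).eventually (lt_mem_nhds h2)
    filter_upwards [h1, hfpos, eventually_ge_atTop 0] with z hz hz2 hz3
    rw [abs_of_nonneg hz3, abs_of_pos hz2, lt_div_iff₀ (hφ_pos z hz3),
      inv_mul_lt_iff₀ (by linarith)] at hz
    exact hz.le
  filter_upwards [hlow, hfpos, eventually_ge_atTop 0,
    hφ_inf.eventually_ge_atTop ((1 + η) * (C / η))] with z hz hz2 hz3 hz4
  refine ⟨hz2, fun Λ hΛ y hy => ?_⟩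
  have h1 := hC y
  have h2 : φ |y| ≤ Λ * φ z :=
    (hmono (abs_nonneg y) (show (0:ℝ) ≤ Λ * z by positivity) hy).trans (hsub Λ hΛ z hz3)
  have h3 : C ≤ η * f z := by
    have : (1 + η) * (C / η) ≤ (1 + η) * f z := hz4.trans hz
    have := le_of_mul_le_mul_left this (by linarith)
    rw [div_le_iff₀ hη] at this
    linarith
  have hΛ0 : 0 < Λ := by linarith
  have h4 : C ≤ η * (Λ * f z) := by
    have : η * f z ≤ η * (Λ * f z) := by
      apply mul_le_mul_of_nonneg_left _ hη.le
      nlinarith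
    linarith
  have h5 : (1 + η) * φ |y| ≤ (1 + η) * (Λ * ((1 + η) * f z)) := by gcongr; exact h2.trans (by gcongr)
  have hP : 0 < Λ * f z := by positivity
  have h6 : (η + (1 + η) * (1 + η)) * (Λ * f z) ≤ (1 + ε) * (Λ * f z) := by
    apply mul_le_mul_of_nonneg_right _ hP.le
    nlinarith
  nlinarith

lemma aux_fpos (f φ γ : ℝ → ℝ) (M : ℝ) (hM : 0 < M) (hf_cont : Continuous f)
    (hφ_inf : Tendsto φ atTop atTop)
    (hfφ : Tendsto (fun y => |f y| / φ |y|) (Filter.cocompact ℝ) (nhds 1))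
    (hγ_cont : ContinuousOn γ (Set.Ioi 0)) (hγ_pos : ∀ t > (0:ℝ), 0 < γ t)
    (hγ_mono : StrictMonoOn γ (Set.Ioi 0)) (hγ_inf : Tendsto γ atTop atTop)
    (hL : ∀ᶠ t in atTop, 1 < γ t / (M * ∫ s in (0:ℝ)..t, f (γ s))) :
    ∀ᶠ y in atTop, 0 < f y := by
  have h1 : ∀ᶠ y in atTop, 1 ≤ |f y| := by
    have := (hfφ.mono_left atTop_le_cocompact).eventually (lt_mem_nhds (show (1/2:ℝ) < 1 by norm_num))
    filter_upwards [this, hφ_inf.eventually_ge_atTop 2, eventually_ge_atTop 0] with y hy h2 h3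
    rw [abs_of_nonneg h3, lt_div_iff₀ (by linarith)] at hy
    linarith
  obtain ⟨Y, hY⟩ := eventually_atTop.1 h1
  by_cases hpos : ∀ y ≥ Y, 0 < f y
  · exact eventually_atTop.2 ⟨Y, hpos⟩
  exfalso
  push Not at hpos
  obtain ⟨y0, hy0, hfy0⟩ := hpos
  have hneg : ∀ y ≥ Y, f y ≤ -1 := by
    intro y hy
    by_contra hcon
    have h2 := hY y hy
    have h3 : 0 < f y := by
      rcases le_abs'.1 h2 with h | h <;> linarith
    have h4 : (0:ℝ) ∈ f '' (Set.Ici Y) :=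
      (isPreconnected_Ici (a := Y)).intermediate_value (show y0 ∈ Set.Ici Y from hy0)
        (show y ∈ Set.Ici Y from hy) hf_cont.continuousOn ⟨hfy0, h3.le⟩
    obtain ⟨w, hw, hw0⟩ := h4
    have := hY w hw
    rw [hw0] at this
    norm_num at this
  obtain ⟨S, hS⟩ := eventually_atTop.1 (hγ_inf.eventually_ge_atTop Y)
  set S' := max S 1
  have hS'0 : 0 < S' := by positivity
  have hev : ∀ᶠ t : ℝ in atTop, False := by
    filter_upwards [hL, eventually_ge_atTop S',
      eventually_ge_atTop (S' + ∫ s in (0:ℝ)..S', f (γ s))] with t h1 h2 h3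
    have i1 := aux_int f γ hf_cont hγ_cont hγ_pos hγ_mono S' hS'0.le
    have i2 := aux_int f γ hf_cont hγ_cont hγ_pos hγ_mono t (hS'0.le.trans h2)
    have i3 := i1.symm.trans i2
    have e := intervalIntegral.integral_add_adjacent_intervals i1 i3
    have b : ∫ s in S'..t, f (γ s) ≤ ∫ s in S'..t, (-1:ℝ) := by
      apply intervalIntegral.integral_mono_on h2 i3 (by simp)
      intro s hs
      exact hneg _ (hS s ((le_max_left _ _).trans hs.1))
    simp at b
    have hJ : ∫ s in (0:ℝ)..t, f (γ s) ≤ 0 := by linarith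
    have : γ t / (M * ∫ s in (0:ℝ)..t, f (γ s)) ≤ 0 :=
      div_nonpos_of_nonneg_of_nonpos (hγ_pos t (by linarith)).le
        (mul_nonpos_of_nonneg_of_nonpos hM.le hJ)
    linarith
  exact hev.exists.choose_spec

lemma aux_main (μ : Measure ℝ) (M : ℝ) (hM : 0 < M)
    (hμ : μ Set.univ = ENNReal.ofReal M)
    (f H x φ φd γ : ℝ → ℝ) (hf_cont : Continuous f)
    (hx_cont : ContinuousOn x (Set.Ici 0))
    (heq : ∀ t ≥ (0:ℝ),
      x t = x 0 + (∫ s in (0:ℝ)..t, (μ (Set.Icc 0 (t - s))).toReal * f (x s)) + H t)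
    (hφ_deriv : ∀ y ≥ (0:ℝ), HasDerivAt φ (φd y) y)
    (hφ_pos : ∀ y ≥ (0:ℝ), 0 < φ y)
    (hφ_inf : Tendsto φ atTop atTop)
    (hφd_pos : ∀ y ≥ (0:ℝ), 0 < φd y)
    (hφd_anti : AntitoneOn φd (Set.Ici 0))
    (hfφ : Tendsto (fun y => |f y| / φ |y|) (Filter.cocompact ℝ) (nhds 1))
    (hγ_cont : ContinuousOn γ (Set.Ioi 0)) (hγ_pos : ∀ t > (0:ℝ), 0 < γ t)
    (hγ_mono : StrictMonoOn γ (Set.Ioi 0)) (hγ_inf : Tendsto γ atTop atTop)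
    (l : ℝ) (hl : 1 ≤ l)
    (hL : ∀ᶠ t in atTop, l < γ t / (M * ∫ s in (0:ℝ)..t, f (γ s)))
    (ε : ℝ) (hε : 0 < ε) :
    ∀ᶠ T in atTop, 0 < T ∧ ∃ A ≥ (0:ℝ), ∀ t ≥ T, ∀ Λ ≥ (1:ℝ),
      (∀ s ∈ Set.Icc T t, |x s| ≤ Λ * γ s) → |x t - H t| ≤ A + (1 + ε) / l * Λ * γ t := by
  have hfpos := aux_fpos f φ γ M hM hf_cont hφ_inf hfφ hγ_cont hγ_pos hγ_mono hγ_inf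
    (hL.mono fun t ht => lt_of_le_of_lt hl ht)
  have hB := hγ_inf.eventually (aux_f_bound f φ φd hf_cont hφ_deriv hφ_pos hφ_inf hφd_pos
    hφd_anti hfφ hfpos ε hε)
  have hl0 : 0 < l := by linarith
  have hint := aux_int f γ hf_cont hγ_cont hγ_pos hγ_mono
  have hJ : ∀ᶠ t in atTop, 0 < (∫ s in (0:ℝ)..t, f (γ s)) ∧
      M * (∫ s in (0:ℝ)..t, f (γ s)) ≤ γ t / l := by
    filter_upwards [hL, eventually_gt_atTop 0] with t ht ht0
    have hg := hγ_pos t ht0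
    have hpos : 0 < M * ∫ s in (0:ℝ)..t, f (γ s) := by
      by_contra hcon
      have := div_nonpos_of_nonneg_of_nonpos hg.le (not_lt.1 hcon)
      linarith
    refine ⟨pos_of_mul_pos_right hpos hM.le, ?_⟩
    rw [lt_div_iff₀ hpos] at ht
    rw [le_div_iff₀ hl0]
    linarith
  filter_upwards [eventually_gt_atTop 0, eventually_forall_ge_atTop.2 hB,
    eventually_forall_ge_atTop.2 hJ] with T hT0 hTB hTJ
  refine ⟨hT0, |x 0| + M * ∫ s in (0:ℝ)..T, |f (x s)|, ?_, ?_⟩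
  · have : 0 ≤ ∫ s in (0:ℝ)..T, |f (x s)| :=
      intervalIntegral.integral_nonneg hT0.le fun s _ => abs_nonneg _
    positivity
  intro t ht Λ hΛ hs
  have ht0 : 0 ≤ t := by linarith
  have : IsFiniteMeasure μ := ⟨by rw [hμ]; exact ENNReal.ofReal_lt_top⟩
  have hm_le : ∀ s, (μ (Set.Icc 0 (t - s))).toReal ≤ M := by
    intro s
    have := measure_mono (μ := μ) (Set.subset_univ (Set.Icc 0 (t - s)))
    rw [hμ] at this
    exact ENNReal.toReal_le_of_le_ofReal hM.le this
  have hm_anti : Antitone fun s => (μ (Set.Icc 0 (t - s))).toReal := by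
    intro a b hab
    apply ENNReal.toReal_mono (measure_ne_top _ _)
    apply measure_mono
    apply Set.Icc_subset_Icc le_rfl
    linarith
  have hfx : ContinuousOn (fun s => f (x s)) (Set.Ici 0) := hf_cont.comp_continuousOn hx_cont
  have hfx0 : ∀ a b, 0 ≤ a → 0 ≤ b → ContinuousOn (fun s => f (x s)) (Set.uIcc a b) :=
    fun a b ha hb => hfx.mono fun s hs => (le_min ha hb).trans hs.1
  have hI : ∀ a b, 0 ≤ a → 0 ≤ b → IntervalIntegrable
      (fun s => (μ (Set.Icc 0 (t - s))).toReal * f (x s)) volume a b :=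
    fun a b ha hb => hm_anti.intervalIntegrable.mul_continuousOn (hfx0 a b ha hb)
  have hpt : ∀ s, |(μ (Set.Icc 0 (t - s))).toReal * f (x s)| ≤ M * |f (x s)| := by
    intro s
    rw [abs_mul, abs_of_nonneg ENNReal.toReal_nonneg]
    exact mul_le_mul_of_nonneg_right (hm_le s) (abs_nonneg _)
  have e := intervalIntegral.integral_add_adjacent_intervals (hI 0 T le_rfl hT0.le) (hI T t hT0.le ht0)
  have b1 : |∫ s in (0:ℝ)..T, (μ (Set.Icc 0 (t - s))).toReal * f (x s)|
      ≤ M * ∫ s in (0:ℝ)..T, |f (x s)| := by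
    rw [← intervalIntegral.integral_const_mul]
    refine (intervalIntegral.abs_integral_le_integral_abs hT0.le).trans ?_
    exact intervalIntegral.integral_mono_on hT0.le (hI 0 T le_rfl hT0.le).abs
      ((hfx0 0 T le_rfl hT0.le).abs.intervalIntegrable.const_mul M) fun s _ => hpt s
  have i3 := (hint T hT0.le).symm.trans (hint t ht0)
  have b2 : |∫ s in T..t, (μ (Set.Icc 0 (t - s))).toReal * f (x s)|
      ≤ M * ((1 + ε) * Λ) * ∫ s in T..t, f (γ s) := by
    rw [← intervalIntegral.integral_const_mul]
    refine (intervalIntegral.abs_integral_le_integral_abs ht).trans ?_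
    refine intervalIntegral.integral_mono_on ht (hI T t hT0.le ht0).abs
      (i3.const_mul _) fun s hs' => (hpt s).trans ?_
    rw [mul_assoc]
    exact mul_le_mul_of_nonneg_left ((hTB s hs'.1).2 Λ hΛ (x s) (hs s hs')) hM.le
  have e2 := intervalIntegral.integral_add_adjacent_intervals (hint T hT0.le) i3
  have j1 := (hTJ T le_rfl).1
  have j2 := (hTJ t ht).2
  have hΛ0 : 0 < Λ := by linarith
  have b3 : M * ((1 + ε) * Λ) * ∫ s in T..t, f (γ s) ≤ (1 + ε) / l * Λ * γ t := by
    calc M * ((1 + ε) * Λ) * ∫ s in T..t, f (γ s)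
        ≤ M * ((1 + ε) * Λ) * ∫ s in (0:ℝ)..t, f (γ s) := by
          gcongr
          linarith
      _ = ((1 + ε) * Λ) * (M * ∫ s in (0:ℝ)..t, f (γ s)) := by ring
      _ ≤ ((1 + ε) * Λ) * (γ t / l) := by gcongr
      _ = _ := by ring
  have hx := heq t ht0
  have : x t - H t = x 0 + ((∫ s in (0:ℝ)..T, (μ (Set.Icc 0 (t - s))).toReal * f (x s)) +
      ∫ s in T..t, (μ (Set.Icc 0 (t - s))).toReal * f (x s)) := by rw [e]; linarith
  rw [this]
  refine (abs_add_le _ _).trans ?_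
  have := abs_add_le (∫ s in (0:ℝ)..T, (μ (Set.Icc 0 (t - s))).toReal * f (x s))
      (∫ s in T..t, (μ (Set.Icc 0 (t - s))).toReal * f (x s))
  linarith

/-- Under (A1), (A2)+(A4), (A±), and (F2) (`γ₊, γ₋` continuous, increasing,
tending to `∞`, with `limsup |H(t)|/γ₊(t) = 0` and `limsup |H(t)|/γ₋(t) = ∞`): if
`γ₊(t)/(M ∫₀ᵗ f(γ₊(s)) ds) → L₊ ∈ (1,∞)` and `γ₋(t)/(M ∫₀ᵗ f(γ₋(s)) ds)` tends to a
limit in `(1,∞)` or to `∞`, then `limsup |x(t)|/γ₊(t) ≤ 1/L₊` and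
`limsup |x(t)|/γ₋(t) = ∞`. -/
theorem stmt10 (μ : Measure ℝ) (M : ℝ) (hM : 0 < M)
    (hμ : μ Set.univ = ENNReal.ofReal M) (hμ0 : μ (Set.Iio 0) = 0)
    (f H x φ φd γp γm : ℝ → ℝ) (Lp : ℝ) (hLp : 1 < Lp)
    (hf_cont : Continuous f)
    (hH_cont : ContinuousOn H (Set.Ici 0))
    (hx_cont : ContinuousOn x (Set.Ici 0))
    (heq : ∀ t ≥ (0:ℝ),
      x t = x 0 + (∫ s in (0:ℝ)..t, (μ (Set.Icc 0 (t - s))).toReal * f (x s)) + H t)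
    (hφ_deriv : ∀ y ≥ (0:ℝ), HasDerivAt φ (φd y) y)
    (hφd_cont : ContinuousOn φd (Set.Ici 0))
    (hφ_pos : ∀ y ≥ (0:ℝ), 0 < φ y)
    (hφ_inf : Tendsto φ atTop atTop)
    (hφd_pos : ∀ y ≥ (0:ℝ), 0 < φd y)
    (hφd_anti : AntitoneOn φd (Set.Ici 0))
    (hφd_zero : Tendsto φd atTop (nhds 0))
    (hfφ : Tendsto (fun y => |f y| / φ |y|) (Filter.cocompact ℝ) (nhds 1))
    (hγp_cont : ContinuousOn γp (Set.Ioi 0)) (hγp_pos : ∀ t > (0:ℝ), 0 < γp t)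
    (hγp_mono : StrictMonoOn γp (Set.Ioi 0)) (hγp_inf : Tendsto γp atTop atTop)
    (hγm_cont : ContinuousOn γm (Set.Ioi 0)) (hγm_pos : ∀ t > (0:ℝ), 0 < γm t)
    (hγm_mono : StrictMonoOn γm (Set.Ioi 0)) (hγm_inf : Tendsto γm atTop atTop)
    (hHγp : Filter.limsup (fun t => ((|H t| / γp t : ℝ) : EReal)) atTop = 0)
    (hHγm : Filter.limsup (fun t => ((|H t| / γm t : ℝ) : EReal)) atTop = ⊤)
    (hLγp : Tendsto (fun t => γp t / (M * ∫ s in (0:ℝ)..t, f (γp s))) atTop (nhds Lp))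
    (hLγm : (∃ Lm : ℝ, 1 < Lm ∧
        Tendsto (fun t => γm t / (M * ∫ s in (0:ℝ)..t, f (γm s))) atTop (nhds Lm)) ∨
      Tendsto (fun t => γm t / (M * ∫ s in (0:ℝ)..t, f (γm s))) atTop atTop) :
    Filter.limsup (fun t => ((|x t| / γp t : ℝ) : EReal)) atTop ≤ ((1 / Lp : ℝ) : EReal) ∧
    Filter.limsup (fun t => ((|x t| / γm t : ℝ) : EReal)) atTop = ⊤ := by
  constructor
  · have hH : ∀ δ > (0:ℝ), ∀ᶠ t in atTop, |H t| ≤ δ * γp t := by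
      intro δ hδ
      have h1 := Filter.eventually_lt_of_limsup_lt (f := atTop)
        (u := fun t => ((|H t| / γp t : ℝ) : EReal)) (b := (δ : EReal))
        (by rw [hHγp]; exact_mod_cast hδ)
      filter_upwards [h1, eventually_gt_atTop 0] with t ht ht0
      have h2 : |H t| / γp t < δ := by exact_mod_cast ht
      rw [div_lt_iff₀ (hγp_pos t ht0)] at h2
      exact h2.le
    -- key estimate
    have key : ∀ θ > 1 / Lp, ∃ θ' < θ, 0 < θ' ∧ ∀ᶠ T in atTop, 0 < T ∧ ∃ A ≥ (0:ℝ), ∀ t ≥ T, ∀ Λ ≥ (1:ℝ),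
        (∀ s ∈ Set.Icc T t, |x s| ≤ Λ * γp s) → |x t - H t| ≤ A + θ' * Λ * γp t := by
      intro θ hθ
      obtain ⟨ε, hε, l, hl1, hlL, hle⟩ : ∃ ε > (0:ℝ), ∃ l : ℝ, 1 ≤ l ∧ l < Lp ∧ (1 + ε) / l < θ := by
        have hLp0 : 0 < Lp := by linarith
        have hθ0 : 0 < θ := lt_trans (by positivity) hθ
        have h1 : θ⁻¹ < Lp := by
          rw [inv_lt_comm₀ hθ0 hLp0]; simpa using hθ
        obtain ⟨l, hl, hl2⟩ := exists_between (max_lt h1 hLp)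
        have hl1 := (le_max_right _ _).trans_lt hl
        have hl3 := (le_max_left _ _).trans_lt hl
        have hl0 : 0 < l := by linarith
        have h4 : 1 < l * θ := by
          rw [inv_lt_iff_one_lt_mul₀ hθ0] at hl3
          linarith
        refine ⟨(l * θ - 1) / 2, by linarith, l, hl1.le, hl2, ?_⟩
        rw [div_lt_iff₀ hl0]
        linarith
      exact ⟨(1 + ε) / l, hle, by positivity, aux_main μ M hM hμ f H x φ φd γp hf_cont hx_cont heq hφ_deriv
        hφ_pos hφ_inf hφd_pos hφd_anti hfφ hγp_cont hγp_pos hγp_mono hγp_inf l hl1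
        (hLγp.eventually (lt_mem_nhds hlL)) ε hε⟩
    have hLinv : 1 / Lp < 1 := by rw [div_lt_one (by linarith)]; exact hLp
    -- a priori bound
    have apriori : ∃ Λ ≥ (1:ℝ), ∀ᶠ t in atTop, |x t| ≤ Λ * γp t := by
      obtain ⟨θ, hθ1, hθ0, hT⟩ := key 1 hLinv
      obtain ⟨T, ⟨hT0, A, hA, hTA⟩, hTH⟩ := (hT.and (eventually_forall_ge_atTop.2 (hH 1 one_pos))).exists
      have hgT := hγp_pos T hT0
      set c := A / γp T + 1 with hc
      have hcomp : ∀ t ≥ T, |x t| ≤ max 1 (c / (1 - θ)) * γp t := by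
        intro t ht
        have hcts : ContinuousOn (fun s => |x s| / γp s) (Set.Icc T t) := by
          apply ContinuousOn.div
          · exact (hx_cont.mono fun s hs => hT0.le.trans hs.1).abs
          · exact hγp_cont.mono fun s hs => hT0.trans_le hs.1
          · exact fun s hs => (hγp_pos s (hT0.trans_le hs.1)).ne'
        obtain ⟨w, hw, hmax⟩ := isCompact_Icc.exists_isMaxOn (Set.nonempty_Icc.2 ht) hcts
        set K := |x w| / γp w with hK
        have hKs : ∀ s ∈ Set.Icc T t, |x s| ≤ K * γp s := by
          intro s hs
          have := hmax hs
          simp only [Set.mem_ofPred_eq] at this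
          rwa [div_le_iff₀ (hγp_pos s (hT0.trans_le hs.1))] at this
        have hw0 : 0 < w := hT0.trans_le hw.1
        have hgw := hγp_pos w hw0
        have h1 := hTA w hw.1 (max 1 K) (le_max_left _ _) (fun s hs =>
          (hKs s ⟨hs.1, hs.2.trans hw.2⟩).trans
            (mul_le_mul_of_nonneg_right (le_max_right _ _) (hγp_pos s (hT0.trans_le hs.1)).le))
        have h2 := hTH w hw.1
        have h3 : |x w| ≤ |x w - H w| + |H w| := by
          have := abs_add_le (x w - H w) (H w)
          simpa using this
        have h4 : A ≤ A / γp T * γp w := by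
          rw [div_mul_eq_mul_div, le_div_iff₀ hgT]
          exact mul_le_mul_of_nonneg_left (hγp_mono.monotoneOn hT0 hw0 hw.1) hA
        have h5 : K ≤ c + θ * max 1 K := by
          rw [hK, div_le_iff₀ hgw, ← hK, hc]
          nlinarith
        have h6 : K ≤ max 1 (c / (1 - θ)) := by
          rcases le_total K 1 with h | h
          · exact h.trans (le_max_left _ _)
          · rw [max_eq_right h] at h5
            refine le_trans ?_ (le_max_right _ _)
            rw [le_div_iff₀ (by linarith)]
            linarith
        exact (hKs t ⟨ht, le_rfl⟩).trans
          (mul_le_mul_of_nonneg_right h6 (hγp_pos t (hT0.trans_le ht)).le)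
      exact ⟨_, le_max_left _ _, eventually_atTop.2 ⟨T, hcomp⟩⟩
    -- improvement
    have improve : ∀ θ > 1 / Lp, ∀ Λ ≥ (1:ℝ), (∀ᶠ t in atTop, |x t| ≤ Λ * γp t) →
        ∀ᶠ t in atTop, |x t| ≤ θ * Λ * γp t := by
      intro θ hθ Λ hΛ hev
      obtain ⟨θ', hθ', hθ0, hT⟩ := key θ hθ
      obtain ⟨T, ⟨hT0, A, hA, hTA⟩, hTx⟩ := (hT.and (eventually_forall_ge_atTop.2 hev)).exists
      have hδ : 0 < (θ - θ') / 2 := by linarith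
      filter_upwards [hH _ hδ, eventually_ge_atTop T,
        hγp_inf.eventually_ge_atTop (A / ((θ - θ') / 2))] with t h1 h2 h3
      have h4 := hTA t h2 Λ hΛ (fun s hs => hTx s hs.1)
      have h5 : |x t| ≤ |x t - H t| + |H t| := by
        have := abs_add_le (x t - H t) (H t)
        simpa using this
      rw [div_le_iff₀ hδ] at h3
      have hg := hγp_pos t (hT0.trans_le h2)
      have h6 : (θ - θ') * γp t ≤ (θ - θ') * Λ * γp t := by
        apply mul_le_mul_of_nonneg_right _ hg.le
        nlinarith
      linarith
    have hone : ∀ᶠ t in atTop, |x t| ≤ 1 * γp t := by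
      obtain ⟨Λ, hΛ, hev⟩ := apriori
      obtain ⟨θ, hθ, hθ1⟩ := exists_between hLinv
      have hθ0 : 0 < θ := lt_trans (by positivity) hθ
      have hind : ∀ n : ℕ, ∀ᶠ t in atTop, |x t| ≤ max 1 (θ ^ n * Λ) * γp t := by
        intro n
        induction n with
        | zero => simpa [max_eq_right hΛ] using hev
        | succ n ih =>
          filter_upwards [improve θ hθ _ (le_max_left _ _) ih, eventually_gt_atTop 0] with t ht ht0
          refine ht.trans (mul_le_mul_of_nonneg_right ?_ (hγp_pos t ht0).le)
          rw [mul_max_of_nonneg _ _ hθ0.le]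
          apply max_le_max
          · linarith
          · rw [pow_succ]; apply le_of_eq; ring
      obtain ⟨n, hn⟩ := exists_pow_lt_of_lt_one (show (0:ℝ) < Λ⁻¹ by positivity) hθ1
      have := hind n
      rwa [max_eq_left] at this
      have h0 := mul_le_mul_of_nonneg_right hn.le (show 0 ≤ Λ by linarith)
      rwa [inv_mul_cancel₀ (by linarith)] at h0
    apply EReal.le_of_forall_lt_iff_le.1
    intro θ hθ
    have hθ' : 1 / Lp < θ := by exact_mod_cast hθ
    refine Filter.limsup_le_of_le (by isBoundedDefault) ?_
    filter_upwards [improve θ hθ' 1 le_rfl hone, eventually_gt_atTop 0] with t ht ht0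
    have : |x t| / γp t ≤ θ := by
      rw [div_le_iff₀ (hγp_pos t ht0)]; linarith
    exact_mod_cast this
  · by_contra hne
    obtain ⟨K, hK, -⟩ := EReal.lt_iff_exists_real_btwn.1 (lt_top_iff_ne_top.2 hne)
    have hL : ∀ᶠ t in atTop, 1 < γm t / (M * ∫ s in (0:ℝ)..t, f (γm s)) := by
      rcases hLγm with ⟨Lm, h1, h2⟩ | h
      · exact h2.eventually (lt_mem_nhds h1)
      · exact h.eventually_gt_atTop 1
    have hT := aux_main μ M hM hμ f H x φ φd γm hf_cont hx_cont heq hφ_deriv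
        hφ_pos hφ_inf hφd_pos hφd_anti hfφ hγm_cont hγm_pos hγm_mono hγm_inf 1 le_rfl hL 1 one_pos
    have hxK : ∀ᶠ t in atTop, |x t| ≤ max 1 K * γm t := by
      filter_upwards [Filter.eventually_lt_of_limsup_lt hK, eventually_gt_atTop 0] with t ht ht0
      have h2 : |x t| / γm t < K := by exact_mod_cast ht
      rw [← div_le_iff₀ (hγm_pos t ht0)]
      exact h2.le.trans (le_max_right _ _)
    obtain ⟨T, ⟨hT0, A, hA, hTA⟩, hTx⟩ := (hT.and (eventually_forall_ge_atTop.2 hxK)).exists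
    have hb : Filter.limsup (fun t => ((|H t| / γm t : ℝ) : EReal)) atTop
        ≤ ((A + 3 * max 1 K : ℝ) : EReal) := by
      refine Filter.limsup_le_of_le (by isBoundedDefault) ?_
      filter_upwards [eventually_ge_atTop T, hγm_inf.eventually_ge_atTop 1] with t h1 h2
      have h4 := hTA t h1 _ (le_max_left 1 K) (fun s hs => hTx s hs.1)
      have h6 := hTx t h1
      have h5 : |H t| ≤ |x t - H t| + |x t| := by
        have := abs_sub (x t) (x t - H t)
        simp only [sub_sub_cancel] at this
        linarith
      have h7 : |H t| / γm t ≤ A + 3 * max 1 K := by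
        rw [div_le_iff₀ (by linarith)]
        nlinarith
      exact_mod_cast h7
    rw [hHγm] at hb
    exact absurd hb (not_le.2 (EReal.coe_lt_top _))
end

section
/- Assume (A1), (A+), (A4), ψ > 0, and that the solution satisfies x(t) > 0 for all t ≥ 0 and x(t) → ∞ as t → ∞. If H(t)/(M ∫₀ᵗ f(H(s)) ds) → ∞ as t → ∞ (that is, L_f(H) = ∞), then x(t)/H(t) → 1 and F(x(t))/(M t) → ∞ as t → ∞. -/
open Filter MeasureTheory

/-- `F(x) = ∫₁ˣ du / f(u)`. -/
noncomputable def Ffun (f : ℝ → ℝ) (x : ℝ) : ℝ := ∫ u in (1:ℝ)..x, 1 / f u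

lemma aux_concave (φ φd : ℝ → ℝ)
    (hφ_deriv : ∀ y ≥ (0:ℝ), HasDerivAt φ (φd y) y)
    (hφ_pos : ∀ y ≥ (0:ℝ), 0 < φ y)
    (hφd_anti : AntitoneOn φd (Set.Ici 0)) {u v : ℝ} (hu : 0 < u) (huv : u ≤ v) :
    φ v * u ≤ φ u * v := by
  rcases huv.eq_or_lt with rfl | huv
  · exact le_rfl
  have hc : ∀ a b : ℝ, 0 ≤ a → ContinuousOn φ (Set.Icc a b) := fun a b ha y hy =>
    (hφ_deriv y (ha.trans hy.1)).continuousAt.continuousWithinAt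
  obtain ⟨c, hc1, hc2⟩ := exists_hasDerivAt_eq_slope φ φd hu (hc 0 u le_rfl)
    (fun y hy => hφ_deriv y hy.1.le)
  obtain ⟨d, hd1, hd2⟩ := exists_hasDerivAt_eq_slope φ φd huv (hc u v hu.le)
    (fun y hy => hφ_deriv y (hu.le.trans hy.1.le))
  have h1 : φd u ≤ φd c := hφd_anti hc1.1.le hu.le hc1.2.le
  have h2 : φd d ≤ φd u := hφd_anti hu.le (hu.le.trans hd1.1.le) hd1.1.le
  have hvu : 0 < v - u := sub_pos.2 huv
  rw [eq_div_iff (by linarith)] at hc2 hd2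
  have h0 := hφ_pos 0 le_rfl
  have h3 : φd u * u ≤ φ u := by nlinarith
  have h4 : φ v - φ u ≤ φd u * (v - u) := by nlinarith
  nlinarith [mul_le_mul_of_nonneg_right h4 hu.le, mul_le_mul_of_nonneg_right h3 hvu.le]

/-- Gronwall type comparison. -/
lemma aux_gronwall (a b K y : ℝ → ℝ) (T : ℝ)
    (hK : ∀ t, HasDerivAt K (a t) t) (hy : ∀ t, HasDerivAt y (b t) t)
    (hKpos : ∀ t ≥ T, 0 < K t) (ha : ∀ t ≥ T, 0 ≤ a t)
    (hb : ∀ t ≥ T, b t ≤ 4 * a t + a t * y t / (2 * K t)) :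
    ∃ C : ℝ, 0 < C ∧ ∀ t ≥ T, y t ≤ C * K t := by
  obtain ⟨C, hC8, hCT⟩ : ∃ C : ℝ, 8 ≤ C ∧ y T ≤ C * K T := by
    refine ⟨max 8 (y T / K T), le_max_left _ _, ?_⟩
    rw [← div_le_iff₀ (hKpos T le_rfl)]
    exact le_max_right _ _
  refine ⟨C, by linarith, ?_⟩
  have hder : ∀ t ≥ T, HasDerivAt (fun s => (y s - C * K s) / √(K s))
      (((b t - C * a t) * √(K t) - (y t - C * K t) * (a t / (2 * √(K t)))) / √(K t) ^ 2) t := by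
    intro t ht
    exact ((hy t).sub ((hK t).const_mul C)).div ((hK t).sqrt (hKpos t ht).ne')
      (Real.sqrt_pos.2 (hKpos t ht)).ne'
  have hanti : AntitoneOn (fun s => (y s - C * K s) / √(K s)) (Set.Ici T) := by
    apply antitoneOn_of_deriv_nonpos (convex_Ici T)
    · exact fun t ht => (hder t ht).continuousAt.continuousWithinAt
    · intro t ht
      rw [interior_Ici] at ht
      exact (hder t (le_of_lt ht)).differentiableAt.differentiableWithinAt
    · intro t ht
      rw [interior_Ici] at ht
      have ht : T ≤ t := le_of_lt ht
      rw [(hder t ht).deriv]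
      apply div_nonpos_of_nonpos_of_nonneg _ (sq_nonneg _)
      have hk := hKpos t ht
      have hs := Real.sqrt_pos.2 hk
      have hsq : √(K t) * √(K t) = K t := Real.mul_self_sqrt hk.le
      have e : a t / (2 * √(K t)) = a t / (2 * K t) * √(K t) := by
        rw [div_mul_eq_mul_div, div_eq_div_iff (by positivity) (by positivity)]
        linear_combination (-2 * a t) * hsq
      rw [e]
      have hb' := hb t ht
      have e2 : a t * y t / (2 * K t) = a t / (2 * K t) * y t := by ring
      have e3 : a t / (2 * K t) * K t = a t / 2 := by field_simp
      rw [e2] at hb'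
      have : b t - C * a t - (y t - C * K t) * (a t / (2 * K t)) ≤ 0 := by
        nlinarith [ha t ht]
      nlinarith
  intro t ht
  have h := hanti (Set.mem_Ici.2 le_rfl) (Set.mem_Ici.2 ht) ht
  have h0 : (y T - C * K T) / √(K T) ≤ 0 :=
    div_nonpos_of_nonpos_of_nonneg (by linarith) (Real.sqrt_nonneg _)
  have h1 : (y t - C * K t) / √(K t) ≤ 0 := le_trans h h0
  have hs := Real.sqrt_pos.2 (hKpos t ht)
  by_contra hlt
  push Not at hlt
  have : 0 < (y t - C * K t) / √(K t) := div_pos (by linarith) hs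
  linarith

lemma aux_ext (f g : ℝ → ℝ) (hf : ContinuousOn f (Set.Ici 0))
    (hg : ContinuousOn g (Set.Ici 0)) (hg0 : ∀ t ≥ (0:ℝ), 0 ≤ g t) :
    Continuous (fun t => f (g (max t 0))) := by
  have h1 : Continuous (fun t : ℝ => g (max t 0)) :=
    hg.comp_continuous (by fun_prop) (fun t => Set.mem_Ici.2 (le_max_right _ _))
  exact hf.comp_continuous h1 (fun t => hg0 _ (le_max_right _ _))

lemma aux_ext_int (f : ℝ → ℝ) (a b : ℝ) (ha : 0 ≤ a) (hb : 0 ≤ b) :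
    ∫ s in a..b, f s = ∫ s in a..b, f (max s 0) := by
  apply intervalIntegral.integral_congr
  intro s hs
  have : 0 ≤ s := (le_min ha hb).trans hs.1
  simp [max_eq_left this]

/-- Under (A1), (A+), (A4), `ψ > 0`, with `x` the positive unbounded solution
of the perturbed Volterra integral equation: if `H(t)/(M ∫₀ᵗ f(H(s)) ds) → ∞`
(i.e. `L_f(H) = ∞`), then `x(t)/H(t) → 1` and `F(x(t))/(Mt) → ∞`. -/
theorem stmt13 (μ : Measure ℝ) (M : ℝ) (hM : 0 < M)
    (hμ : μ Set.univ = ENNReal.ofReal M) (hμ0 : μ (Set.Iio 0) = 0)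
    (f H x φ φd : ℝ → ℝ) (ψ : ℝ) (hψ : 0 < ψ)
    (hf_cont : ContinuousOn f (Set.Ici 0)) (hf_pos : ∀ y ≥ (0:ℝ), 0 < f y)
    (hH_cont : ContinuousOn H (Set.Ici 0)) (hH_nonneg : ∀ t ≥ (0:ℝ), 0 ≤ H t)
    (hx_cont : ContinuousOn x (Set.Ici 0)) (hx0 : x 0 = ψ)
    (heq : ∀ t ≥ (0:ℝ),
      x t = x 0 + (∫ s in (0:ℝ)..t, (μ (Set.Icc 0 (t - s))).toReal * f (x s)) + H t)
    (hφ_deriv : ∀ y ≥ (0:ℝ), HasDerivAt φ (φd y) y)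
    (hφd_cont : ContinuousOn φd (Set.Ici 0))
    (hφ_pos : ∀ y ≥ (0:ℝ), 0 < φ y)
    (hφ_inf : Tendsto φ atTop atTop)
    (hφd_pos : ∀ y ≥ (0:ℝ), 0 < φd y)
    (hφd_anti : AntitoneOn φd (Set.Ici 0))
    (hφd_zero : Tendsto φd atTop (nhds 0))
    (hfφ : Tendsto (fun y => f y / φ y) atTop (nhds 1))
    (hx_pos : ∀ t ≥ (0:ℝ), 0 < x t) (hx_inf : Tendsto x atTop atTop)
    (hLf : Tendsto (fun t => H t / (M * ∫ s in (0:ℝ)..t, f (H s))) atTop atTop) :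
    Tendsto (fun t => x t / H t) atTop (nhds 1) ∧
    Tendsto (fun t => Ffun f (x t) / (M * t)) atTop atTop := by
  have hH_x : ∀ t ≥ (0:ℝ), H t ≤ x t := by
    intro t ht
    have h := heq t ht
    have : 0 ≤ ∫ s in (0:ℝ)..t, (μ (Set.Icc 0 (t - s))).toReal * f (x s) := by
      apply intervalIntegral.integral_nonneg ht
      intro s hs
      exact mul_nonneg ENNReal.toReal_nonneg (hf_pos _ (hx_pos s hs.1).le).le
    linarith
  set a : ℝ → ℝ := fun t => f (H (max t 0)) with ha_def
  set b : ℝ → ℝ := fun t => f (x (max t 0)) with hb_def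
  have hac : Continuous a := aux_ext f H hf_cont hH_cont hH_nonneg
  have hbc : Continuous b := aux_ext f x hf_cont hx_cont (fun t ht => (hx_pos t ht).le)
  have hapos : ∀ t, 0 < a t := fun t => hf_pos _ (hH_nonneg _ (le_max_right _ _))
  have hbpos : ∀ t, 0 < b t := fun t => hf_pos _ (hx_pos _ (le_max_right _ _)).le
  have ha_eq : ∀ t ≥ (0:ℝ), a t = f (H t) := fun t ht => by simp [ha_def, max_eq_left ht]
  have hb_eq : ∀ t ≥ (0:ℝ), b t = f (x t) := fun t ht => by simp [hb_def, max_eq_left ht]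
  set K : ℝ → ℝ := fun t => ∫ s in (0:ℝ)..t, a s with hK_def
  set y : ℝ → ℝ := fun t => (∫ s in (0:ℝ)..t, b s) + ψ / M with hy_def
  have hKd : ∀ t, HasDerivAt K (a t) t := fun t => hac.integral_hasStrictDerivAt 0 t |>.hasDerivAt
  have hyd : ∀ t, HasDerivAt y (b t) t := fun t =>
    (hbc.integral_hasStrictDerivAt 0 t).hasDerivAt.add_const _
  have hKpos : ∀ t > (0:ℝ), 0 < K t := fun t ht =>
    intervalIntegral.intervalIntegral_pos_of_pos (hac.intervalIntegrable _ _) hapos ht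
  have hK_eq : ∀ t ≥ (0:ℝ), ∫ s in (0:ℝ)..t, f (H s) = K t := fun t ht =>
    aux_ext_int (fun s => f (H s)) 0 t le_rfl ht
  have hKmono : Monotone K := monotone_of_hasDerivAt_nonneg hKd (fun t => (hapos t).le)
  have hypos : ∀ t ≥ (0:ℝ), 0 ≤ y t := fun t ht =>
    add_nonneg (intervalIntegral.integral_nonneg ht (fun s _ => (hbpos s).le)) (by positivity)
  -- upper bound for x
  have hx_H : ∀ t ≥ (0:ℝ), x t ≤ H t + M * y t := by
    intro t ht
    have h := heq t ht
    have h1 : ∫ s in (0:ℝ)..t, (μ (Set.Icc 0 (t - s))).toReal * f (x s)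
        ≤ ∫ s in (0:ℝ)..t, M * b s := by
      rw [intervalIntegral.integral_of_le ht, intervalIntegral.integral_of_le ht]
      apply integral_mono_of_nonneg
      · filter_upwards [ae_restrict_mem measurableSet_Ioc] with s hs
        exact mul_nonneg ENNReal.toReal_nonneg (hf_pos _ (hx_pos s hs.1.le).le).le
      · have : IntervalIntegrable (fun s => M * b s) volume 0 t :=
          (hbc.const_mul M).intervalIntegrable _ _
        exact this.1
      · filter_upwards [ae_restrict_mem measurableSet_Ioc] with s hs
        have hm : (μ (Set.Icc 0 (t - s))).toReal ≤ M := by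
          apply ENNReal.toReal_le_of_le_ofReal hM.le
          rw [← hμ]
          exact measure_mono (Set.subset_univ _)
        show _ ≤ M * b s
        rw [hb_eq s hs.1.le]
        exact mul_le_mul_of_nonneg_right hm (hf_pos _ (hx_pos s hs.1.le).le).le
    rw [intervalIntegral.integral_const_mul] at h1
    have h2 : M * y t = M * (∫ s in (0:ℝ)..t, b s) + ψ := by
      simp only [hy_def]
      field_simp
    rw [h2]
    linarith
  -- largeness of H
  have hHK : ∀ N : ℝ, ∀ᶠ t in atTop, N * (M * K t) ≤ H t := by
    intro N
    filter_upwards [hLf.eventually_ge_atTop N, eventually_gt_atTop 0] with t ht h0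
    rw [hK_eq t h0.le] at ht
    exact (le_div_iff₀ (mul_pos hM (hKpos t h0))).1 ht
  have hHinf : Tendsto H atTop atTop := by
    rw [tendsto_atTop]
    intro B
    have hp : 0 < M * K 1 := mul_pos hM (hKpos 1 one_pos)
    filter_upwards [hHK (|B| / (M * K 1)), eventually_ge_atTop 1] with t ht h1
    calc B ≤ |B| := le_abs_self B
      _ = |B| / (M * K 1) * (M * K 1) := (div_mul_cancel₀ _ hp.ne').symm
      _ ≤ |B| / (M * K 1) * (M * K t) := by
        have := hKmono h1
        gcongr
      _ ≤ H t := ht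
  have hlow : ∀ᶠ u in atTop, φ u / 2 ≤ f u := by
    filter_upwards [hfφ.eventually_const_lt (show (1/2:ℝ) < 1 by norm_num), eventually_ge_atTop 0]
      with u hu h0
    have := (lt_div_iff₀ (hφ_pos u h0)).1 hu
    linarith
  have hupp : ∀ᶠ u in atTop, f u ≤ 2 * φ u := by
    filter_upwards [hfφ.eventually_lt_const (show (1:ℝ) < 2 by norm_num), eventually_ge_atTop 0]
      with u hu h0
    exact ((div_lt_iff₀ (hφ_pos u h0)).1 hu).le
  constructor
  · -- x / H → 1
    have hev : ∀ᶠ t in atTop, 0 < t ∧ b t ≤ 4 * a t + a t * y t / (2 * K t) := by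
      filter_upwards [hHK 8, eventually_gt_atTop 0, hHinf.eventually hlow,
        hx_inf.eventually hupp, hHinf.eventually_gt_atTop 0] with t h8 h0 hl hu hHp
      refine ⟨h0, ?_⟩
      have hk := hKpos t h0
      have hc := aux_concave φ φd hφ_deriv hφ_pos hφd_anti hHp (hH_x t h0.le)
      rw [← ha_eq t h0.le] at hl
      rw [← hb_eq t h0.le] at hu
      have hxH := hx_H t h0.le
      have hy0 := hypos t h0.le
      have hφH := hφ_pos _ hHp.le
      have e1 : φ (x t) ≤ φ (H t) * (1 + y t / (8 * K t)) := by
        have e2 : φ (x t) * H t ≤ φ (H t) * (H t + M * y t) :=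
          hc.trans (mul_le_mul_of_nonneg_left hxH hφH.le)
        have e3 : M * y t ≤ H t * (y t / (8 * K t)) := by
          calc M * y t = 8 * (M * K t) * (y t / (8 * K t)) := by field_simp
            _ ≤ H t * (y t / (8 * K t)) := by gcongr
        have e4 : φ (x t) * H t ≤ φ (H t) * (1 + y t / (8 * K t)) * H t := by
          calc _ ≤ _ := e2
            _ ≤ φ (H t) * (H t + H t * (y t / (8 * K t))) := by gcongr
            _ = _ := by ring
        exact le_of_mul_le_mul_right e4 hHp
      have hz : 0 ≤ 1 + y t / (8 * K t) := by positivity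
      calc b t ≤ 2 * φ (x t) := hu
        _ ≤ 2 * (φ (H t) * (1 + y t / (8 * K t))) := by gcongr
        _ ≤ 2 * ((2 * a t) * (1 + y t / (8 * K t))) := by
          gcongr
          linarith
        _ = 4 * a t + a t * y t / (2 * K t) := by
          field_simp
          ring
    obtain ⟨T, hT⟩ := eventually_atTop.1 hev
    obtain ⟨C, hC, hyC⟩ := aux_gronwall a b K y T hKd hyd (fun t ht => hKpos t (hT t ht).1)
      (fun t _ => (hapos t).le) (fun t ht => (hT t ht).2)
    rw [Metric.tendsto_atTop']
    intro ε hε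
    have hfin : ∀ᶠ t in atTop, dist (x t / H t) 1 < ε := by
      filter_upwards [hHK (2 * C / ε), eventually_ge_atTop T, eventually_gt_atTop 0,
        hHinf.eventually_gt_atTop 0] with t h1 h2 h0 hHp
      have hge := hH_x t h0.le
      have hle := hx_H t h0.le
      have hyc := hyC t h2
      have e : x t / H t - 1 = (x t - H t) / H t := by field_simp
      rw [Real.dist_eq, e, abs_of_nonneg (div_nonneg (by linarith) hHp.le), div_lt_iff₀ hHp]
      have h3 : 2 * C * (M * K t) ≤ ε * H t := by
        have := mul_le_mul_of_nonneg_left h1 hε.le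
        have e5 : ε * (2 * C / ε * (M * K t)) = 2 * C * (M * K t) := by field_simp
        linarith
      have h4 : M * y t ≤ C * (M * K t) := by
        have := mul_le_mul_of_nonneg_left hyc hM.le
        linarith
      have h5 : 0 < ε * H t := mul_pos hε hHp
      linarith
    obtain ⟨N, hN⟩ := eventually_atTop.1 hfin
    exact ⟨N, fun t ht => hN t (le_of_lt ht)⟩
  · -- F(x) / (M t) → ∞
    set g : ℝ → ℝ := fun u => 1 / f (max u 0) with hg_def
    have hfc : Continuous (fun u => f (max u 0)) :=
      hf_cont.comp_continuous (by fun_prop) (fun t => Set.mem_Ici.2 (le_max_right _ _))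
    have hgc : Continuous g :=
      continuous_const.div hfc (fun u => (hf_pos _ (le_max_right _ _)).ne')
    have hgpos : ∀ u, 0 < g u := fun u => one_div_pos.2 (hf_pos _ (le_max_right _ _))
    set G : ℝ → ℝ := fun u => ∫ s in (1:ℝ)..u, g s with hG_def
    have hGd : ∀ u, HasDerivAt G (g u) u := fun u =>
      (hgc.integral_hasStrictDerivAt 1 u).hasDerivAt
    have hGmono : Monotone G := monotone_of_hasDerivAt_nonneg hGd (fun t => (hgpos t).le)
    have hFG : ∀ u ≥ (0:ℝ), Ffun f u = G u := fun u hu =>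
      aux_ext_int (fun s => 1 / f s) 1 u zero_le_one hu
    have hKinf : Tendsto K atTop atTop := by
      have hφH : ∀ᶠ t in atTop, 2 ≤ φ (H t) := (hφ_inf.comp hHinf).eventually_ge_atTop 2
      obtain ⟨T, hT⟩ := eventually_atTop.1
        (hφH.and ((hHinf.eventually hlow).and (eventually_ge_atTop 0)))
      have hm : MonotoneOn (fun t => K t - t) (Set.Ici T) := by
        have hd : ∀ t, HasDerivAt (fun t => K t - t) (a t - 1) t := fun t =>
          (hKd t).sub (hasDerivAt_id t)
        apply monotoneOn_of_deriv_nonneg (convex_Ici T)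
        · exact fun t _ => (hd t).continuousAt.continuousWithinAt
        · exact fun t _ => (hd t).differentiableAt.differentiableWithinAt
        · intro t ht
          rw [interior_Ici] at ht
          obtain ⟨h1, h2, h3⟩ := hT t (le_of_lt ht)
          rw [(hd t).deriv, ha_eq t h3]
          linarith
      apply tendsto_atTop_mono' atTop (f₁ := fun t => t + (K T - T))
      · filter_upwards [eventually_ge_atTop T] with t ht
        have := hm (Set.mem_Ici.2 le_rfl) (Set.mem_Ici.2 ht) ht
        simp only at this
        linarith
      · exact tendsto_atTop_add_const_right _ _ tendsto_id
    have hφmono := aux_mono φ φd hφ_deriv hφd_pos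
    rw [tendsto_atTop]
    intro B
    set R : ℝ := |B| + 1 with hR
    have hRpos : 0 < R := by positivity
    have hBR : B < R := by have := le_abs_self B; linarith
    set c : ℝ := 4 * R * M with hc_def
    have hcpos : 0 < c := by positivity
    have hPinf : Tendsto (fun t => c * K t) atTop atTop := hKinf.const_mul_atTop hcpos
    have hev : ∀ᶠ t in atTop, 0 < t ∧ c * K t ≤ H t ∧ R * M ≤ g (c * K t) * (c * a t) := by
      filter_upwards [hHK (4 * R), eventually_gt_atTop 0, hHinf.eventually hlow,
        hPinf.eventually hupp] with t h1 h0 hl hu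
      have hle : c * K t ≤ H t := by
        rw [hc_def]
        linarith
      refine ⟨h0, hle, ?_⟩
      have hP : 0 ≤ c * K t := (mul_pos hcpos (hKpos t h0)).le
      have hm := hφmono hP (hH_nonneg t h0.le) hle
      have hfp := hf_pos _ hP
      rw [← ha_eq t h0.le] at hl
      have hg1 : g (c * K t) = 1 / f (c * K t) := by simp [hg_def, max_eq_left hP]
      rw [hg1, one_div_mul_eq_div, le_div_iff₀ hfp]
      have : f (c * K t) ≤ 4 * a t := by linarith
      calc R * M * f (c * K t) ≤ R * M * (4 * a t) := by gcongr
        _ = c * a t := by rw [hc_def]; ring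
    obtain ⟨T, hT⟩ := eventually_atTop.1 hev
    have hm : MonotoneOn (fun t => G (c * K t) - R * M * t) (Set.Ici T) := by
      have hd : ∀ t, HasDerivAt (fun t => G (c * K t) - R * M * t)
          (g (c * K t) * (c * a t) - R * M * 1) t := fun t =>
        ((hGd (c * K t)).comp t ((hKd t).const_mul c)).sub ((hasDerivAt_id t).const_mul (R * M))
      apply monotoneOn_of_deriv_nonneg (convex_Ici T)
      · exact fun t _ => (hd t).continuousAt.continuousWithinAt
      · exact fun t _ => (hd t).differentiableAt.differentiableWithinAt
      · intro t ht
        rw [interior_Ici] at ht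
        have := (hT t (le_of_lt ht)).2.2
        rw [(hd t).deriv]
        linarith
    set D : ℝ := G (c * K T) - R * M * T with hD
    have hlin : ∀ᶠ t in atTop, -D ≤ (R - B) * M * t :=
      (tendsto_id.const_mul_atTop (mul_pos (sub_pos.2 hBR) hM)).eventually_ge_atTop (-D)
    filter_upwards [hlin, eventually_ge_atTop T] with t h1 h2
    obtain ⟨h0, hle, -⟩ := hT t h2
    rw [hFG _ (hx_pos t h0.le).le, le_div_iff₀ (mul_pos hM h0)]
    have h3 := hm (Set.mem_Ici.2 le_rfl) (Set.mem_Ici.2 h2) h2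
    simp only at h3
    have h4 := hGmono (hle.trans (hH_x t h0.le))
    nlinarith
end

section
/- Let f : (0,∞) → (0,∞) be continuous and suppose there is a C¹ increasing function φ : (0,∞) → (0,∞) with φ(x) → ∞ and φ'(x) → 0 as x → ∞ and f(x)/φ(x) → 1 as x → ∞. Let y : [0,∞) → (0,∞) be the (global, nondecreasing, unbounded) solution of the ordinary differential equation y'(t) = f(y(t)) for t > 0 with y(0) = 1, equivalently y(t) = F⁻¹(t). Then for every N ≥ 1, liminf_{t→∞} y(Nt)/y(t) ≥ N. -/
open Filter MeasureTheory

/-- Let `f : (0,∞) → (0,∞)` be continuous with `f ∼ φ` for a `C¹` increasing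
`φ : (0,∞) → (0,∞)` with `φ(x) → ∞` and `φ'(x) → 0` as `x → ∞`. If `y` is the global,
nondecreasing, unbounded solution of `y' = f(y)`, `y(0) = 1`, then for every `N ≥ 1`,
`liminf_{t→∞} y(Nt)/y(t) ≥ N`. -/
theorem stmt14 (f φ φd y : ℝ → ℝ)
    (hf_cont : ContinuousOn f (Set.Ioi 0)) (hf_pos : ∀ u > (0:ℝ), 0 < f u)
    (hφ_deriv : ∀ u > (0:ℝ), HasDerivAt φ (φd u) u)
    (hφd_cont : ContinuousOn φd (Set.Ioi 0))
    (hφ_pos : ∀ u > (0:ℝ), 0 < φ u)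
    (hφ_mono : StrictMonoOn φ (Set.Ioi 0))
    (hφ_inf : Tendsto φ atTop atTop)
    (hφd_zero : Tendsto φd atTop (nhds 0))
    (hfφ : Tendsto (fun u => f u / φ u) atTop (nhds 1))
    (hy0 : y 0 = 1) (hy_pos : ∀ t ≥ (0:ℝ), 0 < y t)
    (hy_deriv : ∀ t > (0:ℝ), HasDerivAt y (f (y t)) t)
    (hy_mono : MonotoneOn y (Set.Ici 0)) (hy_inf : Tendsto y atTop atTop) :
    ∀ N : ℝ, 1 ≤ N →
      (N : EReal) ≤ Filter.liminf (fun t => ((y (N * t) / y t : ℝ) : EReal)) atTop := by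
  intro N hN
  have key : ∀ ε : ℝ, 0 < ε → ε < 1 →
      ∀ᶠ t in atTop, 1 + (N - 1) * (1 - 3 * ε) ≤ y (N * t) / y t := by
    intro ε hε hε1
    have h1 : ∀ᶠ u in atTop, 1 - ε < f u / φ u :=
      hfφ.eventually (lt_mem_nhds (by linarith))
    have h2 : ∀ᶠ u in atTop, f u / φ u < 1 + ε :=
      hfφ.eventually (gt_mem_nhds (by linarith))
    have h3 := hy_inf.eventually (h1.and h2)
    obtain ⟨T0, hT0⟩ := eventually_atTop.1 h3
    obtain ⟨T, hTT0, hT1⟩ : ∃ T, T0 ≤ T ∧ 1 ≤ T := ⟨max T0 1, le_max_left _ _, le_max_right _ _⟩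
    have hlow : ∀ s ≥ T, (1 - ε) * φ (y s) ≤ f (y s) := by
      intro s hs
      have hp := hφ_pos _ (hy_pos s (by linarith))
      exact ((lt_div_iff₀ hp).1 (hT0 s (by linarith)).1).le
    have hup : ∀ s ≥ T, f (y s) ≤ (1 + ε) * φ (y s) := by
      intro s hs
      have hp := hφ_pos _ (hy_pos s (by linarith))
      exact ((div_lt_iff₀ hp).1 (hT0 s (by linarith)).2).le
    have hφy : ∀ a b, T ≤ a → a ≤ b → φ (y a) ≤ φ (y b) := by
      intro a b ha hab
      have ha0 : 0 ≤ a := by linarith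
      exact hφ_mono.monotoneOn (hy_pos a ha0) (hy_pos b (by linarith))
        (hy_mono ha0 (show (0:ℝ) ≤ b by linarith) hab)
    have hcont : ∀ a b, T ≤ a → ContinuousOn y (Set.Icc a b) := fun a b ha s hs =>
      (hy_deriv s (by linarith [hs.1])).continuousAt.continuousWithinAt
    have hdiff : ∀ a b, T ≤ a → DifferentiableOn ℝ y (interior (Set.Icc a b)) := by
      intro a b ha s hs
      have hs := interior_subset hs
      exact (hy_deriv s (by linarith [hs.1])).differentiableAt.differentiableWithinAt
    filter_upwards [eventually_ge_atTop T, hy_inf.eventually_ge_atTop (y T / ε)] with t ht hyt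
    have hNt : t ≤ N * t := by nlinarith
    have hyp := hy_pos t (by linarith)
    have hp := hφ_pos _ hyp
    have hA : (1 - ε) * φ (y t) * (N * t - t) ≤ y (N * t) - y t := by
      refine Convex.mul_sub_le_image_sub_of_le_deriv (convex_Icc t (N * t)) (hcont _ _ ht)
        (hdiff _ _ ht) ?_ t ⟨le_rfl, hNt⟩ (N * t) ⟨hNt, le_rfl⟩ hNt
      intro s hs
      have hs := interior_subset hs
      rw [(hy_deriv s (by linarith [hs.1])).deriv]
      refine le_trans ?_ (hlow s (by linarith [hs.1]))
      exact mul_le_mul_of_nonneg_left (hφy _ _ ht hs.1) (by linarith)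
    have hB : y t - y T ≤ (1 + ε) * φ (y t) * (t - T) := by
      refine Convex.image_sub_le_mul_sub_of_deriv_le (convex_Icc T t) (hcont _ _ le_rfl)
        (hdiff _ _ le_rfl) ?_ T ⟨le_rfl, ht⟩ t ⟨ht, le_rfl⟩ ht
      intro s hs
      have hs := interior_subset hs
      rw [(hy_deriv s (by linarith [hs.1])).deriv]
      refine le_trans (hup s hs.1) ?_
      exact mul_le_mul_of_nonneg_left (hφy _ _ hs.1 hs.2) (by linarith)
    rw [div_le_iff₀ hε] at hyt
    rw [le_div_iff₀ hyp]
    have hC : (1 - ε) * y t ≤ (1 + ε) * (t * φ (y t)) := by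
      have : 0 ≤ (1 + ε) * φ (y t) * T := by positivity
      nlinarith
    have hD : (1 - 3 * ε) * y t ≤ (1 - ε) * (t * φ (y t)) := by
      have e1 := mul_le_mul_of_nonneg_left hC (show 0 ≤ 1 - ε by linarith)
      have e2 : 0 ≤ 4 * ε ^ 2 * y t := by positivity
      have e3 : (1 + ε) * ((1 - 3 * ε) * y t) ≤ (1 + ε) * ((1 - ε) * (t * φ (y t))) := by
        nlinarith
      exact le_of_mul_le_mul_left e3 (by linarith)
    have hE := mul_le_mul_of_nonneg_left hD (show 0 ≤ N - 1 by linarith)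
    nlinarith
  refine EReal.ge_of_forall_gt_iff_ge.1 ?_
  intro c hc
  have hc' : c < N := by exact_mod_cast hc
  have hε : 0 < min (1 / 2) ((N - c) / (3 * N)) :=
    lt_min (by norm_num) (div_pos (by linarith) (by linarith))
  have hε1 : min (1 / 2) ((N - c) / (3 * N)) < 1 := lt_of_le_of_lt (min_le_left _ _) (by norm_num)
  have hε2 := min_le_right (1 / 2) ((N - c) / (3 * N))
  refine le_liminf_of_le (h := ?_)
  filter_upwards [key _ hε hε1] with t ht
  generalize min (1 / 2) ((N - c) / (3 * N)) = ε at *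
  rw [le_div_iff₀ (by linarith)] at hε2
  have : c ≤ y (N * t) / y t := by nlinarith
  exact_mod_cast this
end

section
/- Let f(x) = √x, let A = ((1+√5)/2)² (the unique A ≥ 1 solving A − √A = 1), and let x(t) = A(t/2)² for t ≥ 0. With H defined from x by the Volterra identity for the kernel e^{−s}, the following hold: (i) H(t)/(t/2)² → 1 as t → ∞; (ii) H(t)/∫₀ᵗ f(H(s)) ds → 1 as t → ∞ (so L_f(H) = 1); (iii) F(x(t))/t → √A = (1+√5)/2 as t → ∞, a value strictly between 1 and 1 + L_f(H) = 2; and (iv) x(t)/H(t) → A as t → ∞. -/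
open Filter MeasureTheory

lemma phi_sq : ((1 + Real.sqrt 5) / 2) ^ 2 = (1 + Real.sqrt 5) / 2 + 1 := by
  have h : Real.sqrt 5 ^ 2 = 5 := Real.sq_sqrt (by norm_num)
  nlinarith

lemma phi_bounds : 1 < (1 + Real.sqrt 5) / 2 ∧ (1 + Real.sqrt 5) / 2 < 2 := by
  have h : Real.sqrt 5 ^ 2 = 5 := Real.sq_sqrt (by norm_num)
  have h0 := Real.sqrt_nonneg 5
  constructor <;> nlinarith

lemma sqrt_x (p s : ℝ) (hp : 0 ≤ p) (hs : 0 ≤ s) :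
    Real.sqrt (p ^ 2 * (s / 2) ^ 2) = p * (s / 2) := by
  rw [← mul_pow, Real.sqrt_sq (by positivity)]

lemma int_one (p t : ℝ) (hp : 0 ≤ p) (ht : 0 ≤ t) :
    ∫ s in (0:ℝ)..t, Real.sqrt (p ^ 2 * (s / 2) ^ 2) = p * (t / 2) ^ 2 := by
  have h1 : ∫ s in (0:ℝ)..t, Real.sqrt (p ^ 2 * (s / 2) ^ 2) = ∫ s in (0:ℝ)..t, p * (s / 2) := by
    apply intervalIntegral.integral_congr
    intro s hs
    rw [Set.uIcc_of_le ht] at hs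
    exact sqrt_x p s hp hs.1
  rw [h1, intervalIntegral.integral_const_mul, intervalIntegral.integral_div, integral_id]
  ring

lemma int_two (p t : ℝ) (hp : 0 ≤ p) (ht : 0 ≤ t) :
    ∫ s in (0:ℝ)..t, Real.exp (-(t - s)) * Real.sqrt (p ^ 2 * (s / 2) ^ 2)
      = p / 2 * (t - 1 + Real.exp (-t)) := by
  have h1 : ∫ s in (0:ℝ)..t, Real.exp (-(t - s)) * Real.sqrt (p ^ 2 * (s / 2) ^ 2)
      = ∫ s in (0:ℝ)..t, Real.exp (-(t - s)) * (p * (s / 2)) := by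
    apply intervalIntegral.integral_congr
    intro s hs
    rw [Set.uIcc_of_le ht] at hs
    simp only [sqrt_x p s hp hs.1]
  rw [h1, intervalIntegral.integral_eq_sub_of_hasDerivAt
    (f := fun s => Real.exp (-(t - s)) * (p / 2 * (s - 1)))]
  · simp
    ring
  · intro s _
    have e1 : HasDerivAt (fun s : ℝ => -(t - s)) 1 s := by
      simpa only [neg_sub, id] using (hasDerivAt_id s).sub_const t
    have e2 : HasDerivAt (fun s : ℝ => p / 2 * (s - 1)) (p / 2) s := by
      simpa using ((hasDerivAt_id s).sub_const 1).const_mul (p / 2)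
    exact (e1.exp.mul e2).congr_deriv (by ring)
  · apply Continuous.intervalIntegrable
    fun_prop

lemma int_F (z : ℝ) (hz : 0 < z) :
    ∫ u in (1:ℝ)..z, 1 / Real.sqrt u = 2 * Real.sqrt z - 2 := by
  have hpos : ∀ u ∈ Set.uIcc 1 z, 0 < u := by
    intro u hu
    exact lt_of_lt_of_le (lt_min one_pos hz) hu.1
  rw [intervalIntegral.integral_eq_sub_of_hasDerivAt (f := fun s => 2 * Real.sqrt s)]
  · simp
  · intro u hu
    have := (Real.hasDerivAt_sqrt (hpos u hu).ne').const_mul 2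
    refine this.congr_deriv ?_
    have := Real.sqrt_pos.2 (hpos u hu)
    field_simp
  · apply ContinuousOn.intervalIntegrable
    apply ContinuousOn.div continuousOn_const Real.continuous_sqrt.continuousOn
    intro u hu
    exact (Real.sqrt_pos.2 (hpos u hu)).ne'

lemma G_lower (p s : ℝ) (hp : 0 ≤ p) :
    (s / 2) ^ 2 ≤ (s / 2) ^ 2 + p / 2 * (s - 1 + Real.exp (-s)) := by
  have := Real.add_one_le_exp (-s)
  have : 0 ≤ p / 2 * (s - 1 + Real.exp (-s)) := mul_nonneg (by positivity) (by linarith)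
  linarith

lemma G_upper (p s : ℝ) (hp : 0 ≤ p) (hs : 0 ≤ s) :
    (s / 2) ^ 2 + p / 2 * (s - 1 + Real.exp (-s)) ≤ (s / 2) ^ 2 + p / 2 * s := by
  have : Real.exp (-s) ≤ 1 := Real.exp_le_one_iff.2 (by linarith)
  have : p / 2 * (s - 1 + Real.exp (-s)) ≤ p / 2 * s :=
    mul_le_mul_of_nonneg_left (by linarith) (by positivity)
  linarith

lemma int_G (p t : ℝ) (hp : 0 ≤ p) (ht : 0 ≤ t) :
    (t / 2) ^ 2 ≤ (∫ s in (0:ℝ)..t, Real.sqrt ((s / 2) ^ 2 + p / 2 * (s - 1 + Real.exp (-s)))) ∧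
    (∫ s in (0:ℝ)..t, Real.sqrt ((s / 2) ^ 2 + p / 2 * (s - 1 + Real.exp (-s))))
      ≤ (t / 2) ^ 2 + p / 2 * t := by
  have hc : IntervalIntegrable
      (fun s => Real.sqrt ((s / 2) ^ 2 + p / 2 * (s - 1 + Real.exp (-s)))) volume 0 t := by
    apply Continuous.intervalIntegrable
    fun_prop
  constructor
  · have h : ∫ s in (0:ℝ)..t, s / 2 = (t / 2) ^ 2 := by
      rw [intervalIntegral.integral_div, integral_id]; ring
    rw [← h]
    apply intervalIntegral.integral_mono_on ht (Continuous.intervalIntegrable (by fun_prop) _ _) hc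
    intro s hs
    exact Real.le_sqrt_of_sq_le (G_lower p s hp)
  · have h : ∫ s in (0:ℝ)..t, (s / 2 + p / 2) = (t / 2) ^ 2 + p / 2 * t := by
      rw [intervalIntegral.integral_add (Continuous.intervalIntegrable (by fun_prop) _ _)
        (Continuous.intervalIntegrable (by fun_prop) _ _), intervalIntegral.integral_div,
        integral_id, intervalIntegral.integral_const]
      simp; ring
    rw [← h]
    apply intervalIntegral.integral_mono_on ht hc (Continuous.intervalIntegrable (by fun_prop) _ _)
    intro s hs
    have h0 : 0 ≤ s := hs.1
    apply Real.sqrt_le_iff.2 ⟨by positivity, _⟩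
    have := G_upper p s hp hs.1
    nlinarith [sq_nonneg p]

lemma squeeze_ratio (p : ℝ) (g : ℝ → ℝ)
    (h : ∀ t, 0 ≤ t → (t / 2) ^ 2 ≤ g t ∧ g t ≤ (t / 2) ^ 2 + p / 2 * t) :
    Tendsto (fun t => g t / (t / 2) ^ 2) atTop (nhds 1) := by
  have h2 : Tendsto (fun t : ℝ => 1 + 2 * p / t) atTop (nhds 1) := by
    simpa using (tendsto_const_nhds (x := (1:ℝ))).add
      ((tendsto_const_nhds (x := 2 * p)).div_atTop tendsto_id)
  apply tendsto_of_tendsto_of_tendsto_of_le_of_le' tendsto_const_nhds h2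
  · filter_upwards [eventually_gt_atTop 0] with t ht
    rw [le_div_iff₀ (by positivity)]
    linarith [(h t ht.le).1]
  · filter_upwards [eventually_gt_atTop 0] with t ht
    rw [div_le_iff₀ (by positivity)]
    have : (1 + 2 * p / t) * (t / 2) ^ 2 = (t / 2) ^ 2 + p / 2 * t := by
      field_simp
    linarith [(h t ht.le).2]

/-- For `f(x) = √x`, `A = ((1+√5)/2)²` (the unique `A ≥ 1` solving
`A − √A = 1`), and `x(t) = A(t/2)²`, with `H` defined from `x` by the Volterra identity
for the kernel `e^{−s}`: (i) `H(t)/(t/2)² → 1`; (ii) `H(t)/∫₀ᵗ f(H(s)) ds → 1`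
(so `L_f(H) = 1`); (iii) `F(x(t))/t → √A = (1+√5)/2`, a value strictly between `1` and
`1 + L_f(H) = 2`; and (iv) `x(t)/H(t) → A`. -/
theorem stmt15 :
    let f : ℝ → ℝ := fun u => Real.sqrt u
    let A : ℝ := ((1 + Real.sqrt 5) / 2) ^ 2
    let x : ℝ → ℝ := fun t => A * (t / 2) ^ 2
    let H : ℝ → ℝ := fun t => x t - x 0 - (∫ s in (0:ℝ)..t, f (x s))
        + ∫ s in (0:ℝ)..t, Real.exp (-(t - s)) * f (x s)
    let F : ℝ → ℝ := fun z => ∫ u in (1:ℝ)..z, 1 / f u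
    (1 ≤ A ∧ A - Real.sqrt A = 1 ∧ ∀ B : ℝ, 1 ≤ B → B - Real.sqrt B = 1 → B = A) ∧
    Tendsto (fun t => H t / (t / 2) ^ 2) atTop (nhds 1) ∧
    Tendsto (fun t => H t / ∫ s in (0:ℝ)..t, f (H s)) atTop (nhds 1) ∧
    (Tendsto (fun t => F (x t) / t) atTop (nhds ((1 + Real.sqrt 5) / 2)) ∧
      1 < (1 + Real.sqrt 5) / 2 ∧ (1 + Real.sqrt 5) / 2 < 2) ∧
    Tendsto (fun t => x t / H t) atTop (nhds A) := by
  intro f A x H F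
  obtain ⟨hp1, hp2⟩ := phi_bounds
  have hsq := phi_sq
  have hAd : A = ((1 + Real.sqrt 5) / 2) ^ 2 := rfl
  set p : ℝ := (1 + Real.sqrt 5) / 2 with hp
  have hp0 : 0 ≤ p := by linarith
  have hH : ∀ t, 0 ≤ t → H t = (t / 2) ^ 2 + p / 2 * (t - 1 + Real.exp (-t)) := by
    intro t ht
    have e1 := int_one p t hp0 ht
    have e2 := int_two p t hp0 ht
    change p ^ 2 * (t / 2) ^ 2 - p ^ 2 * (0 / 2) ^ 2
      - (∫ s in (0:ℝ)..t, Real.sqrt (p ^ 2 * (s / 2) ^ 2))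
      + (∫ s in (0:ℝ)..t, Real.exp (-(t - s)) * Real.sqrt (p ^ 2 * (s / 2) ^ 2)) = _
    rw [e1, e2, hsq]
    ring
  have hI : ∀ t, 0 ≤ t → ∫ s in (0:ℝ)..t, f (H s) =
      ∫ s in (0:ℝ)..t, Real.sqrt ((s / 2) ^ 2 + p / 2 * (s - 1 + Real.exp (-s))) := by
    intro t ht
    apply intervalIntegral.integral_congr
    intro s hs
    rw [Set.uIcc_of_le ht] at hs
    change Real.sqrt (H s) = _
    rw [hH s hs.1]
  have hsA : Real.sqrt A = p := by rw [hAd, Real.sqrt_sq hp0]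
  have T1 : Tendsto (fun t => H t / (t / 2) ^ 2) atTop (nhds 1) := by
    apply squeeze_ratio p
    intro t ht
    rw [hH t ht]
    exact ⟨G_lower p t hp0, G_upper p t hp0 ht⟩
  have T2 : Tendsto (fun t => (∫ s in (0:ℝ)..t, f (H s)) / (t / 2) ^ 2) atTop (nhds 1) := by
    apply squeeze_ratio p
    intro t ht
    rw [hI t ht]
    exact int_G p t hp0 ht
  refine ⟨⟨?_, ?_, ?_⟩, T1, ?_, ⟨?_, hp1, hp2⟩, ?_⟩
  · rw [hAd]; nlinarith
  · rw [hsA, hAd]; linarith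
  · intro B hB hB1
    have hb : Real.sqrt B ^ 2 = B := Real.sq_sqrt (by linarith)
    have hb0 := Real.sqrt_nonneg B
    have h3 : (Real.sqrt B - p) * (Real.sqrt B + p - 1) = 0 := by nlinarith
    rcases mul_eq_zero.1 h3 with h | h
    · rw [hAd, ← hb, sub_eq_zero.1 h]
    · linarith
  · have := T1.div T2 one_ne_zero
    rw [div_one] at this
    refine this.congr' ?_
    filter_upwards [eventually_gt_atTop 0] with t ht
    have h0 : (t / 2) ^ 2 ≠ 0 := by positivity
    exact div_div_div_cancel_right₀ h0 _ _
  · have h2 : Tendsto (fun t : ℝ => p - 2 / t) atTop (nhds p) := by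
      simpa using (tendsto_const_nhds (x := p)).sub
        ((tendsto_const_nhds (x := (2:ℝ))).div_atTop tendsto_id)
    refine h2.congr' ?_
    filter_upwards [eventually_gt_atTop 0] with t ht
    have hx : 0 < p ^ 2 * (t / 2) ^ 2 := by
      have : 0 < p := by linarith
      positivity
    have e : F (x t) = p * t - 2 := by
      change ∫ u in (1:ℝ)..(p ^ 2 * (t / 2) ^ 2), 1 / Real.sqrt u = _
      rw [int_F _ hx, sqrt_x p t hp0 ht.le]
      ring
    rw [e]
    field_simp
  · have := (tendsto_const_nhds (x := A)).div T1 one_ne_zero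
    rw [div_one] at this
    refine this.congr' ?_
    filter_upwards [eventually_gt_atTop 0] with t ht
    have h0 : (t / 2) ^ 2 ≠ 0 := by positivity
    change A / (H t / (t / 2) ^ 2) = A * (t / 2) ^ 2 / H t
    rw [div_div_eq_mul_div]
end

section
/- Let f(x) = (x+e)/log(x+e), fix α ∈ (0,1/2), set P(t) = (1+t)^α + √(2(t+1)) and x(t) = e^{P(t)} − e for t ≥ 0. With H defined from x by the Volterra identity for the kernel e^{−s}, the following hold: (i) there is a constant K > 0 such that H(t)/(K·P(t)^{2α−1}·e^{P(t)}) → 1 as t → ∞; (ii) H(t)/∫₀ᵗ f(H(s)) ds → 1 as t → ∞ (so L_f(H) = 1); (iii) x(t)/H(t) → ∞ as t → ∞; and (iv) F(x(t))/t → 1 as t → ∞. -/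
open Filter MeasureTheory

namespace S16

/-- L'Hopital at infinity. -/
lemma lhop {G G' W W' : ℝ → ℝ} {L : ℝ}
    (hG : ∀ t, 0 < t → HasDerivAt G (G' t) t) (hW : ∀ t, 0 < t → HasDerivAt W (W' t) t)
    (hpos : ∀ᶠ t in atTop, 0 < W' t) (hWt : Tendsto W atTop atTop)
    (hr : Tendsto (fun t => G' t / W' t) atTop (nhds L)) :
    Tendsto (fun t => G t / W t) atTop (nhds L) := by
  rw [Metric.tendsto_nhds] at hr ⊢
  intro ε hε
  have h1 := hr (ε / 2) (by positivity)
  obtain ⟨T, hT⟩ := eventually_atTop.1 (h1.and (hpos.and (eventually_gt_atTop (0:ℝ))))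
  have hT0 : 0 < T := (hT T le_rfl).2.2
  set C : ℝ := ‖G T - L * W T‖ - ε / 2 * W T with hC
  have key : ∀ t, T ≤ t → ‖G t - L * W t‖ ≤ C + ε / 2 * W t := by
    intro t ht
    have hd : ∀ s, 0 < s → HasDerivAt (fun s => G s - L * W s) (G' s - L * W' s) s :=
      fun s hs => (hG s hs).sub ((hW s hs).const_mul L)
    have hb : ∀ s, 0 < s → HasDerivAt (fun s => C + ε / 2 * W s) (ε / 2 * W' s) s :=
      fun s hs => ((hW s hs).const_mul (ε / 2)).const_add C
    refine image_norm_le_of_norm_deriv_right_le_deriv_boundary' (a := T) (b := t)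
      (f := fun s => G s - L * W s) (f' := fun s => G' s - L * W' s)
      (B := fun s => C + ε / 2 * W s) (B' := fun s => ε / 2 * W' s)
      ?_ ?_ ?_ ?_ ?_ ?_ (Set.right_mem_Icc.2 ht)
    · exact fun s hs => (hd s (hT0.trans_le hs.1)).continuousAt.continuousWithinAt
    · exact fun s hs => (hd s (hT0.trans_le hs.1)).hasDerivWithinAt
    · simp [hC]
    · exact fun s hs => (hb s (hT0.trans_le hs.1)).continuousAt.continuousWithinAt
    · exact fun s hs => (hb s (hT0.trans_le hs.1)).hasDerivWithinAt
    · intro s hs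
      obtain ⟨h1, h2, h3⟩ := hT s hs.1
      rw [Real.dist_eq] at h1
      have : G' s - L * W' s = (G' s / W' s - L) * W' s := by field_simp
      rw [this, norm_mul, Real.norm_eq_abs, Real.norm_eq_abs, abs_of_pos h2]
      exact mul_le_mul_of_nonneg_right h1.le h2.le
  filter_upwards [eventually_ge_atTop T, hWt.eventually_gt_atTop 0,
    hWt.eventually_gt_atTop (2 * C / ε)] with t h1 h2 h3
  have := key t h1
  rw [Real.dist_eq]
  have e : G t / W t - L = (G t - L * W t) / W t := by field_simp
  rw [e, abs_div, abs_of_pos h2, div_lt_iff₀ h2]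
  rw [div_lt_iff₀ hε] at h3
  rw [Real.norm_eq_abs] at this
  nlinarith

lemma prim_deriv {g : ℝ → ℝ} (hg : ContinuousOn g (Set.Ici 0)) (t : ℝ) (ht : 0 < t) :
    HasDerivAt (fun t => ∫ s in (0:ℝ)..t, g s) (g t) t := by
  apply intervalIntegral.integral_hasDerivAt_right
  · apply ContinuousOn.intervalIntegrable
    rw [Set.uIcc_of_le ht.le]
    exact hg.mono (fun s hs => hs.1)
  · exact ContinuousOn.stronglyMeasurableAtFilter isOpen_Ioi
      (hg.mono Set.Ioi_subset_Ici_self) t ht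
  · exact hg.continuousAt (Ici_mem_nhds ht)

lemma prim_cont {g : ℝ → ℝ} (hg : ContinuousOn g (Set.Ici 0)) :
    ContinuousOn (fun t => ∫ s in (0:ℝ)..t, g s) (Set.Ici 0) := by
  have hc : Continuous (fun s : ℝ => g |s|) := by
    rw [← continuousOn_univ]
    exact hg.comp continuous_abs.continuousOn (fun s _ => abs_nonneg s)
  have : Continuous (fun t => ∫ s in (0:ℝ)..t, g |s|) :=
    intervalIntegral.continuous_primitive (fun a b => hc.intervalIntegrable a b) 0
  refine this.continuousOn.congr ?_
  intro t ht
  apply intervalIntegral.integral_congr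
  intro s hs
  rw [Set.uIcc_of_le ht] at hs
  simp only [abs_of_nonneg hs.1]

/-- the exponent -/
noncomputable def P (α t : ℝ) : ℝ := (1 + t) ^ α + Real.sqrt (2 * (t + 1))
/-- its derivative -/
noncomputable def P' (α t : ℝ) : ℝ := α * (1 + t) ^ (α - 1) + 1 / Real.sqrt (2 * (t + 1))
/-- leading constant -/
noncomputable def c (α : ℝ) : ℝ := α * √2 + 1 / √2
/-- comparison function -/
noncomputable def W (α t : ℝ) : ℝ := (1 + t) ^ (α - 1 / 2) * Real.exp (P α t)
/-- its log derivative -/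
noncomputable def R (α t : ℝ) : ℝ := P' α t + (α - 1 / 2) / (1 + t)

lemma P_eq {α t : ℝ} (ht : 0 ≤ t) :
    P α t = √(1 + t) * ((1 + t) ^ (α - 1 / 2) + √2) := by
  have h : 0 < 1 + t := by linarith
  rw [P, mul_add (√(1 + t)), Real.sqrt_eq_rpow (1 + t), ← Real.rpow_add h, ← Real.sqrt_eq_rpow, add_comm t 1,
    Real.sqrt_mul (by norm_num), mul_comm √2]
  congr 2; ring

lemma P'_eq {α t : ℝ} (ht : 0 ≤ t) :
    P' α t = (α * (1 + t) ^ (α - 1 / 2) + 1 / √2) / √(1 + t) := by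
  have h : 0 < 1 + t := by linarith
  rw [P', add_div, Real.sqrt_eq_rpow (1 + t), mul_div_assoc, ← Real.rpow_sub h,
    ← Real.sqrt_eq_rpow, add_comm t 1,
    Real.sqrt_mul (by norm_num), div_div]
  congr 3; ring

lemma PP' {α t : ℝ} (ht : 0 ≤ t) :
    P α t * P' α t = 1 + (1 + t) ^ (α - 1 / 2) * (α * (1 + t) ^ (α - 1 / 2) + c α) := by
  rw [P_eq ht, P'_eq ht, c]
  have h : 0 < √(1 + t) := Real.sqrt_pos.2 (by linarith)
  have h2 : 0 < √2 := by positivity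
  have h3 := Real.sq_sqrt (show (0:ℝ) ≤ 2 by norm_num)
  field_simp
  ring_nf

lemma P_gt {α t : ℝ} (ht : 0 ≤ t) : 1 < P α t := by
  have h : 0 < (1 + t) ^ α := Real.rpow_pos_of_pos (by linarith) _
  have : (1:ℝ) < √(2 * (t + 1)) := by
    rw [Real.lt_sqrt (by norm_num)]; linarith
  unfold P; linarith

lemma P_cont {α : ℝ} (h0 : 0 < α) : Continuous (P α) := by
  unfold P
  have : Continuous (fun t : ℝ => (1 + t) ^ α) :=
    (Real.continuous_rpow_const h0.le).comp (continuous_const.add continuous_id)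
  fun_prop

lemma P_deriv {α t : ℝ} (ht : 0 ≤ t) : HasDerivAt (P α) (P' α t) t := by
  have h1 : HasDerivAt (fun t : ℝ => (1 + t) ^ α) (1 * α * (1 + t) ^ (α - 1)) t :=
    ((hasDerivAt_id t).const_add 1).rpow_const (Or.inl (by simp; linarith))
  have h2 : HasDerivAt (fun t : ℝ => √(2 * (t + 1))) (2 * 1 / (2 * √(2 * (t + 1)))) t :=
    (((hasDerivAt_id t).add_const 1).const_mul 2).sqrt (by simp; linarith)
  refine (h1.add h2).congr_deriv ?_
  unfold P'
  congr 1
  · ring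
  · field_simp

lemma W_deriv {α t : ℝ} (ht : 0 ≤ t) : HasDerivAt (W α) (W α t * R α t) t := by
  have h : 0 < 1 + t := by linarith
  have h1 : HasDerivAt (fun t : ℝ => (1 + t) ^ (α - 1 / 2))
      (1 * (α - 1 / 2) * (1 + t) ^ (α - 1 / 2 - 1)) t :=
    ((hasDerivAt_id t).const_add 1).rpow_const (Or.inl (by simp; linarith))
  refine (h1.mul (P_deriv (α := α) ht).exp).congr_deriv ?_
  rw [Real.rpow_sub_one h.ne', W, R]
  ring

lemma W_pos {α t : ℝ} (ht : 0 ≤ t) : 0 < W α t :=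
  mul_pos (Real.rpow_pos_of_pos (by linarith) _) (Real.exp_pos _)

lemma c_pos {α : ℝ} (h0 : 0 < α) : 0 < c α := by unfold c; positivity

lemma tau : Tendsto (fun t : ℝ => 1 + t) atTop atTop :=
  tendsto_atTop_add_const_left _ _ tendsto_id

lemma phi_lim {α : ℝ} (h : α < 1 / 2) :
    Tendsto (fun t : ℝ => (1 + t) ^ (α - 1 / 2)) atTop (nhds 0) := by
  have := (tendsto_rpow_neg_atTop (show 0 < 1 / 2 - α by linarith)).comp tau
  refine this.congr (fun t => ?_)
  simp

lemma sq_lim : Tendsto (fun t : ℝ => √(1 + t)) atTop atTop :=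
  Real.tendsto_sqrt_atTop.comp tau

lemma Psq {α : ℝ} (h : α < 1 / 2) :
    Tendsto (fun t : ℝ => P α t / √(1 + t)) atTop (nhds √2) := by
  have : Tendsto (fun t : ℝ => (1 + t) ^ (α - 1 / 2) + √2) atTop (nhds (0 + √2)) :=
    (phi_lim h).add_const _
  rw [zero_add] at this
  refine this.congr' ?_
  filter_upwards [eventually_ge_atTop (0:ℝ)] with t ht
  have h : 0 < √(1 + t) := Real.sqrt_pos.2 (by linarith)
  rw [P_eq ht]; field_simp

lemma P_lim {α : ℝ} (h : α < 1 / 2) : Tendsto (P α) atTop atTop := by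
  have := (Psq h).pos_mul_atTop (by positivity) sq_lim
  refine this.congr' ?_
  filter_upwards [eventually_ge_atTop (0:ℝ)] with t ht
  have h : 0 < √(1 + t) := Real.sqrt_pos.2 (by linarith)
  field_simp

lemma PP'_lim {α : ℝ} (h : α < 1 / 2) :
    Tendsto (fun t => P α t * P' α t) atTop (nhds 1) := by
  have := ((phi_lim h).mul (((phi_lim h).const_mul α).add_const (c α))).const_add 1
  rw [zero_mul, add_zero] at this
  refine this.congr' ?_
  filter_upwards [eventually_ge_atTop (0:ℝ)] with t ht
  rw [PP' ht]

lemma Pt_lim {α : ℝ} (h : α < 1 / 2) :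
    Tendsto (fun t => P α t / (1 + t)) atTop (nhds 0) := by
  have := (Psq h).mul (tendsto_inv_atTop_zero.comp sq_lim)
  rw [mul_zero] at this
  refine this.congr' ?_
  filter_upwards [eventually_ge_atTop (0:ℝ)] with t ht
  have h : 0 < √(1 + t) := Real.sqrt_pos.2 (by linarith)
  have h2 := Real.sq_sqrt (show 0 ≤ 1 + t by linarith)
  simp only [Function.comp]
  rw [div_mul_eq_mul_div, div_eq_div_iff h.ne' (by linarith)]
  rw [mul_assoc, inv_mul_eq_div, ← mul_div_assoc, eq_comm, eq_div_iff h.ne', mul_assoc, ← sq, h2]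

lemma PR_lim {α : ℝ} (h : α < 1 / 2) :
    Tendsto (fun t => P α t * R α t) atTop (nhds 1) := by
  have := (PP'_lim h).add ((Pt_lim h).const_mul (α - 1 / 2))
  rw [mul_zero, add_zero] at this
  refine this.congr (fun t => ?_)
  unfold R; ring

lemma R_lim {α : ℝ} (h : α < 1 / 2) : Tendsto (R α) atTop (nhds 0) := by
  have := (PR_lim h).mul (tendsto_inv_atTop_zero.comp (P_lim h))
  rw [mul_zero] at this
  refine this.congr' ?_
  filter_upwards [eventually_ge_atTop (0:ℝ)] with t ht
  have := P_gt (α := α) ht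
  have h3 : P α t ≠ 0 := by linarith
  simp only [Function.comp]
  field_simp

lemma R_pos {α : ℝ} (h : α < 1 / 2) : ∀ᶠ t in atTop, 0 < R α t := by
  filter_upwards [eventually_ge_atTop (0:ℝ), (PR_lim h).eventually_const_lt zero_lt_one] with t ht h2
  have := P_gt (α := α) ht
  exact (pos_iff_pos_of_mul_pos h2).1 (by linarith)

lemma log_lim {α : ℝ} (h : α < 1 / 2) :
    Tendsto (fun t => Real.log (1 + t) / P α t) atTop (nhds 0) := by
  have h1 : Tendsto (fun t : ℝ => Real.log (1 + t) / √(1 + t)) atTop (nhds 0) := by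
    have := ((isLittleO_log_rpow_atTop (show (0:ℝ) < 1 / 2 by norm_num)).tendsto_div_nhds_zero).comp
      tau
    refine this.congr (fun t => ?_)
    simp [Real.sqrt_eq_rpow]
  have := h1.mul ((Psq h).inv₀ (by positivity))
  rw [zero_mul] at this
  refine this.congr' ?_
  filter_upwards [eventually_ge_atTop (0:ℝ)] with t ht
  have h : 0 < √(1 + t) := Real.sqrt_pos.2 (by linarith)
  have := P_gt (α := α) ht
  have h3 : P α t ≠ 0 := by linarith
  field_simp

lemma logW {α t : ℝ} (ht : 0 ≤ t) :
    Real.log (W α t) = (α - 1 / 2) * Real.log (1 + t) + P α t := by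
  have h : 0 < 1 + t := by linarith
  rw [W, Real.log_mul (Real.rpow_pos_of_pos h _).ne' (Real.exp_pos _).ne', Real.log_rpow h,
    Real.log_exp]

lemma logWP {α : ℝ} (h : α < 1 / 2) :
    Tendsto (fun t => Real.log (W α t) / P α t) atTop (nhds 1) := by
  have := ((log_lim h).const_mul (α - 1 / 2)).add_const 1
  rw [mul_zero, zero_add] at this
  refine this.congr' ?_
  filter_upwards [eventually_ge_atTop (0:ℝ)] with t ht
  have := P_gt (α := α) ht
  have h3 : P α t ≠ 0 := by linarith
  rw [logW ht]; field_simp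

lemma W_lim {α : ℝ} (h : α < 1 / 2) : Tendsto (W α) atTop atTop := by
  have h1 : Tendsto (fun t => Real.log (W α t)) atTop atTop := by
    have := (logWP h).pos_mul_atTop zero_lt_one (P_lim h)
    refine this.congr' ?_
    filter_upwards [eventually_ge_atTop (0:ℝ)] with t ht
    have := P_gt (α := α) ht
    have h3 : P α t ≠ 0 := by linarith
    field_simp
  refine (Real.tendsto_exp_atTop.comp h1).congr' ?_
  filter_upwards [eventually_ge_atTop (0:ℝ)] with t ht
  exact Real.exp_log (W_pos ht)

/-- f along x -/
noncomputable def g (α t : ℝ) : ℝ := Real.exp (P α t) / P α t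
/-- first part of H -/
noncomputable def G (α t : ℝ) : ℝ :=
  Real.exp (P α t) - Real.exp (P α 0) - ∫ s in (0:ℝ)..t, g α s
/-- weighted integral -/
noncomputable def E (α t : ℝ) : ℝ := ∫ s in (0:ℝ)..t, Real.exp s * g α s
/-- H -/
noncomputable def HH (α t : ℝ) : ℝ := G α t + Real.exp (-t) * E α t

lemma g_cont {α : ℝ} (h0 : 0 < α) : ContinuousOn (g α) (Set.Ici 0) := by
  refine ContinuousOn.div (Real.continuous_exp.comp (P_cont h0)).continuousOn
    (P_cont h0).continuousOn ?_
  intro t ht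
  have := P_gt (α := α) ht
  linarith

lemma g_pos {α t : ℝ} (ht : 0 ≤ t) : 0 < g α t :=
  div_pos (Real.exp_pos _) (by have := P_gt (α := α) ht; linarith)

lemma eg_cont {α : ℝ} (h0 : 0 < α) :
    ContinuousOn (fun s => Real.exp s * g α s) (Set.Ici 0) :=
  Real.continuous_exp.continuousOn.mul (g_cont h0)

lemma G_deriv {α t : ℝ} (h0 : 0 < α) (ht : 0 < t) :
    HasDerivAt (G α) (Real.exp (P α t) * P' α t - g α t) t :=
  ((P_deriv ht.le).exp.sub_const _).sub (prim_deriv (g_cont h0) t ht)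

lemma G_deriv_eq {α t : ℝ} (ht : 0 ≤ t) :
    Real.exp (P α t) * P' α t - g α t =
      W α t * (α * (1 + t) ^ (α - 1 / 2) + c α) / P α t := by
  have := P_gt (α := α) ht
  have h3 : P α t ≠ 0 := by linarith
  have h4 := PP' (α := α) ht
  rw [g, W]
  generalize (1 + t) ^ (α - 1 / 2) = φ at *
  field_simp
  linear_combination h4

lemma G_cont {α : ℝ} (h0 : 0 < α) : ContinuousOn (G α) (Set.Ici 0) :=
  ((Real.continuous_exp.comp (P_cont h0)).continuousOn.sub continuousOn_const).sub
    (prim_cont (g_cont h0))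

lemma HH_cont {α : ℝ} (h0 : 0 < α) : ContinuousOn (HH α) (Set.Ici 0) :=
  (G_cont h0).add ((Real.continuous_exp.comp continuous_neg).continuousOn.mul
    (prim_cont (eg_cont h0)))

lemma G_nonneg {α t : ℝ} (h0 : 0 < α) (ht : 0 ≤ t) : 0 ≤ G α t := by
  have hm : MonotoneOn (G α) (Set.Ici 0) := by
    apply monotoneOn_of_deriv_nonneg (convex_Ici 0) (G_cont h0)
    · rw [interior_Ici]
      exact fun s hs => (G_deriv h0 hs).differentiableAt.differentiableWithinAt
    · rw [interior_Ici]
      intro s hs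
      have hs' : 0 ≤ s := le_of_lt hs
      rw [(G_deriv h0 hs).deriv, G_deriv_eq hs']
      have := P_gt (α := α) hs'
      have h1 := W_pos (α := α) hs'
      have h2 := c_pos h0
      have h3 : 0 < (1 + s) ^ (α - 1 / 2) := Real.rpow_pos_of_pos (by linarith) _
      positivity
  have := hm (Set.mem_Ici.2 le_rfl) ht ht
  simpa [G] using this

lemma HH_nonneg {α t : ℝ} (h0 : 0 < α) (ht : 0 ≤ t) : 0 ≤ HH α t := by
  have : 0 ≤ E α t := intervalIntegral.integral_nonneg ht
    (fun s hs => mul_nonneg (Real.exp_pos _).le (g_pos hs.1).le)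
  have := G_nonneg h0 ht
  unfold HH; positivity

lemma G_lim {α : ℝ} (h0 : 0 < α) (h : α < 1 / 2) :
    Tendsto (fun t => G α t / W α t) atTop (nhds (c α)) := by
  refine lhop (fun t ht => G_deriv h0 ht) (fun t ht => W_deriv ht.le) ?_ (W_lim h) ?_
  · filter_upwards [R_pos h, eventually_ge_atTop (0:ℝ)] with t h1 h2
    exact mul_pos (W_pos h2) h1
  · have := (((phi_lim h).const_mul α).add_const (c α)).div (PR_lim h) one_ne_zero
    rw [mul_zero, zero_add, div_one] at this
    refine this.congr' ?_
    filter_upwards [R_pos h, eventually_ge_atTop (0:ℝ)] with t h1 ht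
    rw [G_deriv_eq ht]
    have := P_gt (α := α) ht
    have h3 : P α t ≠ 0 := by linarith
    have h4 := W_pos (α := α) ht
    simp only [Pi.div_apply]
    field_simp

lemma E_lim {α : ℝ} (h0 : 0 < α) (h : α < 1 / 2) :
    Tendsto (fun t => E α t / (Real.exp t * W α t)) atTop (nhds 0) := by
  refine lhop (G := E α) (W := fun t => Real.exp t * W α t)
    (W' := fun t => Real.exp t * W α t + Real.exp t * (W α t * R α t))
    (fun t ht => prim_deriv (eg_cont h0) t ht)
    (fun t ht => (Real.hasDerivAt_exp t).mul (W_deriv ht.le)) ?_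
    (Real.tendsto_exp_atTop.atTop_mul_atTop₀ (W_lim h)) ?_
  · filter_upwards [R_pos h, eventually_ge_atTop (0:ℝ)] with t h1 h2
    have := W_pos (α := α) h2
    positivity
  · have a1 : Tendsto (fun t : ℝ => ((1 + t) ^ α)⁻¹) atTop (nhds 0) :=
      tendsto_inv_atTop_zero.comp ((tendsto_rpow_atTop h0).comp tau)
    have a2 : Tendsto (fun t : ℝ => (P α t / √(1 + t))⁻¹) atTop (nhds (√2)⁻¹) :=
      (Psq h).inv₀ (by positivity)
    have a3 := ((R_lim h).const_add 1).inv₀ (by norm_num)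
    have := (a1.mul a2).mul a3
    rw [zero_mul, zero_mul] at this
    refine this.congr' ?_
    filter_upwards [R_pos h, eventually_ge_atTop (0:ℝ)] with t h1 ht
    have := P_gt (α := α) ht
    have h3 : 0 < P α t := by linarith
    have h5 : 0 < √(1 + t) := Real.sqrt_pos.2 (by linarith)
    have h6 : 0 < 1 + t := by linarith
    have h7 : (1 + t) ^ α = (1 + t) ^ (α - 1 / 2) * √(1 + t) := by
      rw [Real.sqrt_eq_rpow, ← Real.rpow_add h6]; congr 1; ring
    have h8 : 0 < (1 + t) ^ (α - 1 / 2) := Real.rpow_pos_of_pos h6 _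
    rw [h7, W, g]
    generalize (1 + t) ^ (α - 1 / 2) = φ at *
    have h9 : 0 < 1 + R α t := by linarith
    field_simp

lemma HH_lim {α : ℝ} (h0 : 0 < α) (h : α < 1 / 2) :
    Tendsto (fun t => HH α t / W α t) atTop (nhds (c α)) := by
  have := (G_lim h0 h).add (E_lim h0 h)
  rw [add_zero] at this
  refine this.congr (fun t => ?_)
  rw [HH, Real.exp_neg, add_div]
  congr 1
  rw [inv_mul_eq_div, div_div]

lemma HHe_lim {α : ℝ} (h0 : 0 < α) (h : α < 1 / 2) :
    Tendsto (fun t => (HH α t + Real.exp 1) / W α t) atTop (nhds (c α)) := by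
  have := (HH_lim h0 h).add ((tendsto_inv_atTop_zero.comp (W_lim h)).const_mul (Real.exp 1))
  rw [mul_zero, add_zero] at this
  refine this.congr (fun t => ?_)
  simp only [Function.comp]
  ring

lemma logH_lim {α : ℝ} (h0 : 0 < α) (h : α < 1 / 2) :
    Tendsto (fun t => Real.log (HH α t + Real.exp 1) / P α t) atTop (nhds 1) := by
  have := (((HHe_lim h0 h).log (c_pos h0).ne').mul
    (tendsto_inv_atTop_zero.comp (P_lim h))).add (logWP h)
  rw [mul_zero, zero_add] at this
  refine this.congr' ?_
  filter_upwards [eventually_ge_atTop (0:ℝ)] with t ht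
  have h1 := HH_nonneg h0 ht
  have h2 := W_pos (α := α) ht
  have h3 := Real.exp_pos 1
  rw [Real.log_div (by positivity) h2.ne']
  simp only [Function.comp]
  ring

/-- the nonlinearity -/
noncomputable def f (u : ℝ) : ℝ := (u + Real.exp 1) / Real.log (u + Real.exp 1)

lemma log_pos' {u : ℝ} (hu : 0 ≤ u) : 0 < Real.log (u + Real.exp 1) := by
  apply Real.log_pos
  have := Real.add_one_lt_exp (one_ne_zero)
  linarith

lemma fH_cont {α : ℝ} (h0 : 0 < α) : ContinuousOn (fun t => f (HH α t)) (Set.Ici 0) := by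
  have h1 : ContinuousOn (fun t => HH α t + Real.exp 1) (Set.Ici 0) :=
    (HH_cont h0).add continuousOn_const
  refine h1.div (h1.log ?_) ?_
  · intro t ht
    have := HH_nonneg h0 ht
    have := Real.exp_pos 1
    positivity
  · intro t ht
    exact (log_pos' (HH_nonneg h0 ht)).ne'

lemma Q_lim {α : ℝ} (h0 : 0 < α) (h : α < 1 / 2) :
    Tendsto (fun t => (∫ s in (0:ℝ)..t, f (HH α s)) / W α t) atTop (nhds (c α)) := by
  refine lhop (fun t ht => prim_deriv (fH_cont h0) t ht) (fun t ht => W_deriv ht.le) ?_ (W_lim h) ?_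
  · filter_upwards [R_pos h, eventually_ge_atTop (0:ℝ)] with t h1 h2
    exact mul_pos (W_pos h2) h1
  · have := (HHe_lim h0 h).div ((logH_lim h0 h).mul (PR_lim h)) (by norm_num)
    rw [mul_one, div_one] at this
    refine this.congr' ?_
    filter_upwards [R_pos h, eventually_ge_atTop (0:ℝ)] with t h1 ht
    have := P_gt (α := α) ht
    have h3 : P α t ≠ 0 := by linarith
    have h4 := W_pos (α := α) ht
    have h5 := log_pos' (HH_nonneg h0 ht)
    simp only [Pi.div_apply, f]
    field_simp

lemma fx (α t : ℝ) : f (Real.exp (P α t) - Real.exp 1) = g α t := by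
  simp [f, g]

lemma F_eq {z : ℝ} (hz : 0 < z) : (∫ u in (1:ℝ)..z, 1 / f u) =
    Real.log (z + Real.exp 1) ^ 2 / 2 - Real.log (1 + Real.exp 1) ^ 2 / 2 := by
  have hpos : ∀ u ∈ Set.uIcc 1 z, 0 < u := by
    intro u hu
    rw [Set.mem_uIcc] at hu
    rcases hu with hu | hu <;> linarith
  have he := Real.exp_pos 1
  apply intervalIntegral.integral_eq_sub_of_hasDerivAt
    (f := fun u => Real.log (u + Real.exp 1) ^ 2 / 2)
  · intro u hu
    have hu := hpos u hu
    have := ((((hasDerivAt_id u).add_const (Real.exp 1)).log (by simp; positivity)).pow 2).div_const 2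
    refine this.congr_deriv ?_
    simp [f]
    field_simp
  · apply ContinuousOn.intervalIntegrable
    have : ContinuousOn (fun u => Real.log (u + Real.exp 1) / (u + Real.exp 1)) (Set.uIcc 1 z) := by
      have h1 : ContinuousOn (fun u : ℝ => u + Real.exp 1) (Set.uIcc 1 z) := by fun_prop
      refine (h1.log ?_).div h1 ?_
      all_goals
        intro u hu
        have := hpos u hu
        positivity
    refine this.congr (fun u hu => ?_)
    simp [f]

end S16

open S16 in
theorem stmt16 (α : ℝ) (hα : α ∈ Set.Ioo (0:ℝ) (1/2)) :
    let f : ℝ → ℝ := fun u => (u + Real.exp 1) / Real.log (u + Real.exp 1)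
    let P : ℝ → ℝ := fun t => (1 + t) ^ α + Real.sqrt (2 * (t + 1))
    let x : ℝ → ℝ := fun t => Real.exp (P t) - Real.exp 1
    let H : ℝ → ℝ := fun t => x t - x 0 - (∫ s in (0:ℝ)..t, f (x s))
        + ∫ s in (0:ℝ)..t, Real.exp (-(t - s)) * f (x s)
    let F : ℝ → ℝ := fun z => ∫ u in (1:ℝ)..z, 1 / f u
    (∃ K > (0:ℝ),
      Tendsto (fun t => H t / (K * P t ^ (2 * α - 1) * Real.exp (P t))) atTop (nhds 1)) ∧
    Tendsto (fun t => H t / ∫ s in (0:ℝ)..t, f (H s)) atTop (nhds 1) ∧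
    Tendsto (fun t => x t / H t) atTop atTop ∧
    Tendsto (fun t => F (x t) / t) atTop (nhds 1) := by
  obtain ⟨h0, h⟩ := hα
  intro f P x H F
  have hf : f = S16.f := rfl
  have hP : P = S16.P α := rfl
  have hx : ∀ t, x t = Real.exp (S16.P α t) - Real.exp 1 := fun t => rfl
  have hH : H = HH α := by
    funext t
    have hfx : ∀ s, f (x s) = g α s := fun s => fx α s
    simp only [H, hfx]
    rw [HH, G, E, ← intervalIntegral.integral_const_mul]
    congr 1
    · rw [hx, hx]; ring
    · apply intervalIntegral.integral_congr
      intro s _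
      simp only
      rw [← mul_assoc, ← Real.exp_add]
      congr 2; ring
  have hF : F = fun z => ∫ u in (1:ℝ)..z, 1 / S16.f u := rfl
  clear_value H F P f x
  subst hH hf hP hF
  have hc := c_pos h0
  refine ⟨⟨c α / (√2) ^ (2 * α - 1), by positivity, ?_⟩, ?_, ?_, ?_⟩
  · have a1 : Tendsto (fun t => (S16.P α t / √(1 + t)) ^ (2 * α - 1)) atTop
        (nhds ((√2) ^ (2 * α - 1))) :=
      (Psq h).rpow_const (Or.inl (by positivity))
    have a2 : (√2) ^ (2 * α - 1) ≠ 0 := by positivity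
    have := ((HH_lim h0 h).div (a1.const_mul (c α / (√2) ^ (2 * α - 1))) (by positivity))
    rw [div_mul_cancel₀ _ a2, div_self hc.ne'] at this
    refine this.congr' ?_
    filter_upwards [eventually_ge_atTop (0:ℝ)] with t ht
    have hp := P_gt (α := α) ht
    have hp0 : 0 < S16.P α t := by linarith
    have h6 : 0 < 1 + t := by linarith
    have h7 : (√(1 + t)) ^ (2 * α - 1) = (1 + t) ^ (α - 1 / 2) := by
      rw [Real.sqrt_eq_rpow, ← Real.rpow_mul h6.le]; congr 1; ring
    have h8 : 0 < (1 + t) ^ (α - 1 / 2) := Real.rpow_pos_of_pos h6 _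
    have h9 : 0 < S16.P α t ^ (2 * α - 1) := Real.rpow_pos_of_pos hp0 _
    simp only [Pi.div_apply]
    rw [Real.div_rpow hp0.le (Real.sqrt_nonneg _), h7, W]
    generalize (1 + t) ^ (α - 1 / 2) = φ at *
    field_simp
  · have := (HH_lim h0 h).div (Q_lim h0 h) hc.ne'
    rw [div_self hc.ne'] at this
    refine this.congr' ?_
    filter_upwards [eventually_ge_atTop (0:ℝ)] with t ht
    have h4 := W_pos (α := α) ht
    simp only [Pi.div_apply]
    rw [div_div_div_cancel_right₀ h4.ne']
  · -- x / W → ∞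
    have hpos : ∀ᶠ t in atTop, 0 < HH α t / W α t :=
      (HH_lim h0 h).eventually_const_lt hc
    have b1 : Tendsto (fun t : ℝ => (1 + t) ^ (1 / 2 - α)) atTop atTop :=
      (tendsto_rpow_atTop (by linarith)).comp tau
    have b2 : Tendsto (fun t => Real.exp 1 * (W α t)⁻¹) atTop (nhds (Real.exp 1 * 0)) :=
      (tendsto_inv_atTop_zero.comp (W_lim h)).const_mul _
    have b3 := b1.atTop_add b2.neg
    have := b3.atTop_mul_pos (inv_pos.2 hc) ((HH_lim h0 h).inv₀ hc.ne')
    refine this.congr' ?_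
    filter_upwards [eventually_ge_atTop (0:ℝ), hpos] with t ht h5
    have h4 := W_pos (α := α) ht
    have h6 : 0 < 1 + t := by linarith
    have h7 : (1 + t) ^ (1 / 2 - α) = Real.exp (S16.P α t) / W α t := by
      rw [W, show 1 / 2 - α = -(α - 1 / 2) by ring, Real.rpow_neg h6.le]
      have h8 : 0 < (1 + t) ^ (α - 1 / 2) := Real.rpow_pos_of_pos h6 _
      field_simp
    have h9 : 0 < HH α t := by
      rcases div_pos_iff.1 h5 with h | h
      · exact h.1
      · linarith [h.2]
    rw [h7, hx]
    field_simp
    ring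
  · set C := Real.log (1 + Real.exp 1) ^ 2 / 2
    have c1 : Tendsto (fun t : ℝ => (1 + t) / t) atTop (nhds 1) := by
      have := (tendsto_inv_atTop_zero (𝕜 := ℝ)).add_const 1
      rw [zero_add] at this
      refine this.congr' ?_
      filter_upwards [eventually_gt_atTop (0:ℝ)] with t ht
      field_simp
    have := ((((Psq h).pow 2).mul c1).div_const 2).sub
      ((tendsto_inv_atTop_zero (𝕜 := ℝ)).const_mul C)
    rw [Real.sq_sqrt (by norm_num), mul_zero, mul_one, sub_zero, div_self (by norm_num)] at this
    refine this.congr' ?_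
    filter_upwards [eventually_gt_atTop (0:ℝ)] with t ht
    have hp := P_gt (α := α) ht.le
    have hxp : 0 < x t := by
      rw [hx]; have := Real.exp_lt_exp.2 hp; linarith
    rw [F_eq hxp, hx, sub_add_cancel, Real.log_exp, div_pow, Real.sq_sqrt (by linarith)]
    have : 1 + t ≠ 0 := by linarith
    simp only [C]
    field_simp
end
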